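/- Let m ≥ 2 and D = {0,1,…,m−1}. For Lebesgue-almost every (γ,λ) ∈ Γ(0,1/m), the Hausdorff dimension of K_{γ,λ} equals 1 + log(mλ)/log(1/γ). -/

import Mathlib

open MeasureTheory Filter Set
open scoped ENNReal Topology

noncomputable section

/-- The self-affine set `K_{γ,λ}` for a digit set `d : Fin m → ℝ`:
`K_{γ,λ} = {∑ₙ d(ωₙ)(γⁿ, λⁿ) : ω ∈ (Fin m)^ℕ}`. -/
def Kaff (m : ℕ) (d : Fin m → ℝ) (g l : ℝ) : Set (ℝ × ℝ) :=
  {p | ∃ ω : ℕ → Fin m, p = (∑' n, d (ω n) * g ^ n, ∑' n, d (ω n) * l ^ n)}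

/-- `Γ(a,b) = {(γ,λ) : 0 < γ < λ < 1, 1/m < λ, a < γλ < b}`. -/
def Gamma (m : ℕ) (a b : ℝ) : Set (ℝ × ℝ) :=
  {p | 0 < p.1 ∧ p.1 < p.2 ∧ p.2 < 1 ∧ 1 / (m : ℝ) < p.2 ∧ a < p.1 * p.2 ∧ p.1 * p.2 < b}

open scoped NNReal

/-- The linear form `∑ a_k k^i x^k`, i.e. `(x d/dx)^i` applied to the polynomial `∑ a_k x^k`. -/
def Jr {N : ℕ} (i : ℕ) (x : ℝ) (a : Fin N → ℝ) : ℝ := ∑ k, a k * (k : ℝ) ^ i * x ^ (k : ℕ)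

/-- Pairs of words of length `N`. -/
abbrev PW (m N : ℕ) := (Fin N → Fin m) × (Fin N → Fin m)

/-- digits of a word -/
def dg {m N : ℕ} (u : Fin N → Fin m) : Fin N → ℝ := fun k => ((u k : ℕ) : ℝ)

/-- difference of a pair of words -/
def df {m N : ℕ} (p : PW m N) : Fin N → ℝ := fun k => dg p.1 k - dg p.2 k

/-- The pairs of words which are close together with their derivatives. -/
def AS (m N j k : ℕ) (g l α β : ℝ) : Set (PW m N) :=
  {p | (∀ i ≤ j, |Jr i g (df p)| ≤ α) ∧ (∀ i ≤ k, |Jr i l (df p)| ≤ β)}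

lemma Jr_df {m N : ℕ} (i : ℕ) (x : ℝ) (p : PW m N) :
    Jr i x (df p) = Jr i x (dg p.1) - Jr i x (dg p.2) := by
  simp only [Jr, df, ← Finset.sum_sub_distrib]
  refine Finset.sum_congr rfl fun k _ => by ring

lemma abs_df_le {m N : ℕ} (p : PW m N) (k : Fin N) : |df p k| ≤ m := by
  have h1 := (p.1 k).2
  have h2 := (p.2 k).2
  have h1' : ((p.1 k : ℕ) : ℝ) < m := by exact_mod_cast h1
  have h2' : ((p.2 k : ℕ) : ℝ) < m := by exact_mod_cast h2
  have h3 : (0:ℝ) ≤ ((p.1 k : ℕ) : ℝ) := by positivity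
  have h4 : (0:ℝ) ≤ ((p.2 k : ℕ) : ℝ) := by positivity
  simp only [df, dg, abs_le]
  constructor <;> linarith

lemma count_eq_le {W B : Type*} [Fintype W] (f g : W → B)
    (h : ∀ u v, g u = g v → f u = f v) :
    {p : W × W | f p.1 = g p.2}.ncard ≤ {p : W × W | f p.1 = f p.2}.ncard := by
  classical
  set T : Finset B := Finset.univ.image f ∪ Finset.univ.image g
  have key : ∀ a b : W → B, (∀ u, a u ∈ T) → 
      {p : W × W | a p.1 = b p.2}.ncard =
      ∑ z ∈ T, (Finset.univ.filter fun u => a u = z).card *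
        (Finset.univ.filter fun u => b u = z).card := by
    intro a b ha
    rw [Set.ncard_eq_toFinset_card']
    rw [Finset.card_eq_sum_card_fiberwise (f := fun p : W × W => a p.1) (t := T)
      (fun p _ => ha p.1)]
    refine Finset.sum_congr rfl fun z _ => ?_
    rw [← Finset.card_product]
    congr 1
    ext ⟨u, v⟩
    simp
    constructor
    · rintro ⟨h1, h2⟩; exact ⟨h2, h1 ▸ h2⟩
    · rintro ⟨h1, h2⟩; exact ⟨h1.trans h2.symm, h1⟩
  have hf : ∀ u, f u ∈ T := fun u => by simp [T]
  have hg : ∀ u, g u ∈ T := fun u => by simp [T]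
  have e1 := key f g hf
  have e2 := key f f hf
  have e3 := key g g hg
  have h3 : {p : W × W | g p.1 = g p.2}.ncard ≤ {p : W × W | f p.1 = f p.2}.ncard :=
    Set.ncard_le_ncard (fun p hp => h _ _ hp) (Set.toFinite _)
  have : 2 * {p : W × W | f p.1 = g p.2}.ncard ≤
      {p : W × W | f p.1 = f p.2}.ncard + {p : W × W | g p.1 = g p.2}.ncard := by
    rw [e1, e2, e3, Finset.mul_sum, ← Finset.sum_add_distrib]
    refine Finset.sum_le_sum fun z _ => ?_
    have := two_mul_le_add_sq ((Finset.univ.filter fun u => f u = z).card)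
      ((Finset.univ.filter fun u => g u = z).card)
    nlinarith
  omega

lemma cover_abs {W ι : Type*} [Fintype W] [Fintype ι] (X : W → ι → ℝ) (r : ι → ℝ)
    (hr : ∀ i, 0 < r i) (c : ι → ℝ) (K : ℕ) :
    {p : W × W | ∀ i, |X p.1 i - X p.2 i - c i| ≤ K * r i}.ncard ≤
      (2 * K + 2) ^ (Fintype.card ι) *
        {p : W × W | ∀ i, |X p.1 i - X p.2 i| ≤ r i}.ncard := by
  classical
  set Z : W → ι → ℤ := fun u i => ⌊X u i / r i⌋
  set S : Finset (ι → ℤ) :=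
    Fintype.piFinset fun i => Finset.Icc (⌊c i / r i⌋ - K) (⌊c i / r i⌋ + K + 1)
  have hS : S.card = (2 * K + 2) ^ (Fintype.card ι) := by
    simp only [S, Fintype.card_piFinset, Int.card_Icc]
    rw [Finset.prod_congr rfl (g := fun _ => 2 * K + 2)]
    · simp
    · intro i _; omega
  have hsub : {p : W × W | ∀ i, |X p.1 i - X p.2 i - c i| ≤ K * r i} ⊆
      ⋃ s ∈ S, {p : W × W | Z p.1 = Z p.2 + s} := by
    intro p hp
    simp only [Set.mem_iUnion]
    refine ⟨Z p.1 - Z p.2, ?_, by simp⟩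
    simp only [S, Fintype.mem_piFinset, Finset.mem_Icc, Pi.sub_apply, Z]
    intro i
    have h := hp i
    have hri := hr i
    have h' : |X p.1 i / r i - X p.2 i / r i - c i / r i| ≤ K := by
      rw [← sub_div, ← sub_div, abs_div, abs_of_pos hri, div_le_iff₀ hri]
      exact h
    rw [abs_le] at h'
    generalize X p.1 i / r i = a at *
    generalize X p.2 i / r i = b at *
    generalize c i / r i = d at *
    have a1 := Int.floor_le a
    have a2 := Int.lt_floor_add_one a
    have b1 := Int.floor_le b
    have b2 := Int.lt_floor_add_one b
    have d1 := Int.floor_le d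
    have d2 := Int.lt_floor_add_one d
    constructor
    · have : (⌊d⌋ : ℝ) - K < (⌊a⌋ - ⌊b⌋ : ℝ) + 1 := by linarith
      have : ⌊d⌋ - K < (⌊a⌋ - ⌊b⌋) + 1 := by exact_mod_cast this
      omega
    · have : (⌊a⌋ - ⌊b⌋ : ℝ) < (⌊d⌋ : ℝ) + K + 2 := by linarith
      have : (⌊a⌋ - ⌊b⌋) < ⌊d⌋ + K + 2 := by exact_mod_cast this
      omega
  have hZ : {p : W × W | Z p.1 = Z p.2} ⊆ {p : W × W | ∀ i, |X p.1 i - X p.2 i| ≤ r i} := by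
    intro p hp i
    have h := congrFun hp i
    have hri := hr i
    have := Int.abs_sub_lt_one_of_floor_eq_floor h
    rw [← sub_div, abs_div, abs_of_pos hri, div_lt_iff₀ hri] at this
    linarith
  calc _ ≤ (⋃ s ∈ S, {p : W × W | Z p.1 = Z p.2 + s}).ncard :=
        Set.ncard_le_ncard hsub (Set.toFinite _)
    _ ≤ ∑ s ∈ S, {p : W × W | Z p.1 = Z p.2 + s}.ncard := by
        exact Finset.set_ncard_biUnion_le S _
    _ ≤ ∑ s ∈ S, {p : W × W | Z p.1 = Z p.2}.ncard := by
        refine Finset.sum_le_sum fun s _ => ?_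
        refine count_eq_le Z (fun v => Z v + s) ?_
        intro u v h
        exact add_right_cancel h
    _ = S.card * {p : W × W | Z p.1 = Z p.2}.ncard := by simp
    _ ≤ _ := by
        rw [hS]
        exact Nat.mul_le_mul_left _ (Set.ncard_le_ncard hZ (Set.toFinite _))

lemma cover_AS (m N j k : ℕ) (g l α β : ℝ) (hα : 0 < α) (hβ : 0 < β) (c d : ℕ → ℝ) (K : ℕ) :
    {p : PW m N | (∀ i ≤ j, |Jr i g (df p) - c i| ≤ K * α) ∧
      (∀ i ≤ k, |Jr i l (df p) - d i| ≤ K * β)}.ncard ≤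
      (2 * K + 2) ^ (j + k + 2) * (AS m N j k g l α β).ncard := by
  have := cover_abs (W := Fin N → Fin m) (ι := Fin (j + 1) ⊕ Fin (k + 1))
    (fun u => Sum.elim (fun i => Jr i g (dg u)) (fun i => Jr i l (dg u)))
    (Sum.elim (fun _ => α) (fun _ => β)) (by rintro (i | i) <;> simpa)
    (Sum.elim (fun i => c i) (fun i => d i)) K
  simp only [Fintype.card_sum, Fintype.card_fin, Sum.forall, Sum.elim_inl, Sum.elim_inr,
    Fin.forall_iff, Nat.lt_succ_iff] at this
  have e : j + 1 + (k + 1) = j + k + 2 := by ring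
  rw [e] at this
  simpa only [AS, Jr_df] using this

lemma tail_bound (m : ℕ) (x : ℝ) (hx0 : 0 < x) (hx1 : x < 1) (J : ℕ) :
    ∃ S : ℕ, ∀ i ≤ J, ∀ (M : ℕ) (b : Fin M → ℝ), (∀ k, |b k| ≤ m) → ∀ q : ℕ,
      |∑ k, b k * ((q : ℝ) + (k : ℕ)) ^ i * x ^ (q + (k : ℕ))| ≤ S * (1 + q) ^ J * x ^ q := by
  have hs : Summable fun k : ℕ => ((k : ℝ) + 1) ^ J * x ^ k := by
    have h1 := summable_pow_mul_geometric_of_norm_lt_one (R := ℝ) J (r := x)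
      (by rw [Real.norm_eq_abs, abs_of_pos hx0]; exact hx1)
    have h2 := (summable_nat_add_iff 1).2 h1
    have h3 := h2.mul_left x⁻¹
    refine h3.congr fun k => ?_
    push_cast
    rw [pow_succ]
    field_simp
  obtain ⟨S, hS⟩ := exists_nat_ge ((m : ℝ) * ∑' k : ℕ, ((k : ℝ) + 1) ^ J * x ^ k)
  refine ⟨S, fun i hi M b hb q => ?_⟩
  calc |∑ k, b k * ((q : ℝ) + (k : ℕ)) ^ i * x ^ (q + (k : ℕ))|
      ≤ ∑ k : Fin M, |b k * ((q : ℝ) + (k : ℕ)) ^ i * x ^ (q + (k : ℕ))| :=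
        Finset.abs_sum_le_sum_abs _ _
    _ ≤ ∑ k : Fin M, ((1 + q : ℝ) ^ J * x ^ q) * m * (((k : ℕ) + 1 : ℝ) ^ J * x ^ (k : ℕ)) := by
        refine Finset.sum_le_sum fun k _ => ?_
        rw [abs_mul, abs_mul, abs_of_nonneg (by positivity : (0:ℝ) ≤ x ^ (q + (k : ℕ))),
          abs_of_nonneg (by positivity : (0:ℝ) ≤ ((q : ℝ) + (k : ℕ)) ^ i)]
        have h1 : ((q : ℝ) + (k : ℕ)) ^ i ≤ (1 + q : ℝ) ^ J * ((k : ℕ) + 1 : ℝ) ^ J := by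
          rw [← mul_pow]
          have hq : (0:ℝ) ≤ q := by positivity
          have hk : (0:ℝ) ≤ (k : ℕ) := by positivity
          calc ((q : ℝ) + (k : ℕ)) ^ i ≤ ((1 + q) * ((k : ℕ) + 1 : ℝ)) ^ i := by
                gcongr; nlinarith
            _ ≤ _ := by
                refine pow_le_pow_right₀ ?_ hi
                nlinarith
        calc |b k| * ((q : ℝ) + (k : ℕ)) ^ i * x ^ (q + (k : ℕ))
            ≤ m * ((1 + q : ℝ) ^ J * ((k : ℕ) + 1 : ℝ) ^ J) * x ^ (q + (k : ℕ)) := by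
              gcongr; exact hb k
          _ = _ := by rw [pow_add]; ring
    _ = ((1 + q : ℝ) ^ J * x ^ q) * (m * ∑ k : Fin M, (((k : ℕ) + 1 : ℝ) ^ J * x ^ (k : ℕ))) := by
        rw [← Finset.mul_sum]; ring
    _ ≤ ((1 + q : ℝ) ^ J * x ^ q) * S := by
        gcongr
        refine le_trans ?_ hS
        gcongr
        rw [Fin.sum_univ_eq_sum_range (fun k => ((k:ℕ) + 1 : ℝ) ^ J * x ^ k)]
        exact hs.sum_le_tsum _ (fun k _ => by positivity)
    _ = _ := by ring

/-- initial part of a pair of words -/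
def pre {m q M : ℕ} (p : PW m (q + M)) : PW m q :=
  (fun k => p.1 (Fin.castAdd M k), fun k => p.2 (Fin.castAdd M k))

/-- suffix of a pair of words -/
def suf {m q M : ℕ} (p : PW m (q + M)) : PW m M :=
  (fun k => p.1 (Fin.natAdd q k), fun k => p.2 (Fin.natAdd q k))

lemma pre_suf_inj {m q M : ℕ} (p p' : PW m (q + M)) (h1 : pre p = pre p') (h2 : suf p = suf p') :
    p = p' := by
  simp only [pre, suf, Prod.mk.injEq, funext_iff] at h1 h2
  ext k : 2
  · refine Fin.addCases (fun i => ?_) (fun i => ?_) k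
    · exact h1.1 i
    · exact h2.1 i
  · refine Fin.addCases (fun i => ?_) (fun i => ?_) k
    · exact h1.2 i
    · exact h2.2 i

lemma Jr_split {m q M : ℕ} (i : ℕ) (x : ℝ) (p : PW m (q + M)) :
    Jr i x (df p) = Jr i x (df (pre p)) +
      ∑ k : Fin M, df (suf p) k * ((q : ℝ) + (k : ℕ)) ^ i * x ^ (q + (k : ℕ)) := by
  simp only [Jr, Fin.sum_univ_add]
  congr 1
  refine Finset.sum_congr rfl fun k _ => ?_
  simp [df, dg, suf]

lemma Jr_shift {M : ℕ} (i q : ℕ) (x : ℝ) (b : Fin M → ℝ) :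
    x ^ q * Jr i x b = ∑ l ∈ Finset.range (i + 1),
      ((i.choose l : ℝ) * (-(q : ℝ)) ^ (i - l)) *
        ∑ k : Fin M, b k * ((q : ℝ) + (k : ℕ)) ^ l * x ^ (q + (k : ℕ)) := by
  simp only [Jr, Finset.mul_sum]
  rw [Finset.sum_comm]
  refine Finset.sum_congr rfl fun k _ => ?_
  have : ((k : ℕ) : ℝ) ^ i = (((q : ℝ) + (k : ℕ)) + (-(q : ℝ))) ^ i := by congr 1; ring
  rw [this, add_pow, Finset.mul_sum, Finset.sum_mul, Finset.mul_sum]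
  refine Finset.sum_congr rfl fun l _ => ?_
  rw [pow_add]; ring

lemma Jr_shift_bound {M : ℕ} (i q : ℕ) (x : ℝ) (hx : 0 < x) (b : Fin M → ℝ) (t : ℕ → ℝ) (ρ : ℝ)
    (h : ∀ l ≤ i, |(∑ k : Fin M, b k * ((q : ℝ) + (k : ℕ)) ^ l * x ^ (q + (k : ℕ))) - t l| ≤ ρ) :
    |Jr i x b - (x ^ q)⁻¹ * ∑ l ∈ Finset.range (i + 1),
      ((i.choose l : ℝ) * (-(q : ℝ)) ^ (i - l)) * t l| ≤ (1 + q) ^ i * ((x ^ q)⁻¹ * ρ) := by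
  have hxq : 0 < x ^ q := by positivity
  have e : Jr i x b = (x ^ q)⁻¹ * (x ^ q * Jr i x b) := by field_simp
  rw [e, Jr_shift, ← mul_sub, abs_mul, abs_of_pos (by positivity : 0 < (x ^ q)⁻¹),
    ← Finset.sum_sub_distrib]
  rw [mul_left_comm]
  gcongr
  calc _ ≤ ∑ l ∈ Finset.range (i + 1), |((i.choose l : ℝ) * (-(q : ℝ)) ^ (i - l)) *
        (∑ k : Fin M, b k * ((q : ℝ) + (k : ℕ)) ^ l * x ^ (q + (k : ℕ))) -
        ((i.choose l : ℝ) * (-(q : ℝ)) ^ (i - l)) * t l| := Finset.abs_sum_le_sum_abs _ _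
    _ ≤ ∑ l ∈ Finset.range (i + 1), ((1:ℝ) ^ l * (q : ℝ) ^ (i - l) * (i.choose l : ℝ)) * ρ := by
        refine Finset.sum_le_sum fun l hl => ?_
        rw [← mul_sub, abs_mul, abs_mul, abs_pow, abs_neg, Nat.abs_cast, Nat.abs_cast]
        have := h l (by simpa [Nat.lt_succ_iff] using hl)
        rw [one_pow, one_mul, mul_comm ((q:ℝ) ^ _)]
        gcongr
    _ = (1 + q) ^ i * ρ := by rw [← Finset.sum_mul, ← add_pow]

lemma rec_split {m q M : ℕ} (S : Set (PW m (q + M))) (P : Set (PW m q)) (B : ℕ)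
    (h1 : ∀ p ∈ S, pre p ∈ P)
    (h2 : ∀ π : PW m q, {t : PW m M | ∃ p ∈ S, pre p = π ∧ suf p = t}.ncard ≤ B) :
    S.ncard ≤ B * P.ncard := by
  classical
  rw [Set.ncard_eq_toFinset_card', Set.ncard_eq_toFinset_card']
  refine Finset.card_le_mul_card_image_of_maps_to (f := pre) (fun p hp => ?_) B fun π _ => ?_
  · simp only [Set.mem_toFinset] at hp ⊢; exact h1 p hp
  · refine le_trans ?_ (h2 π)
    rw [Set.ncard_eq_toFinset_card']
    refine Finset.card_le_card_of_injOn suf ?_ ?_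
    · intro p hp
      simp at hp ⊢
      exact ⟨p.1, p.2, hp.1, hp.2, rfl⟩
    · intro p hp p' hp' h
      simp at hp hp'
      exact pre_suf_inj p p' (hp.2.trans hp'.2.symm) h

lemma rec_bad (m : ℕ) (g l : ℝ) (hg0 : 0 < g) (hg1 : g < 1) (hl0 : 0 < l) (hl1 : l < 1) (J : ℕ) :
    ∃ S : ℕ, ∀ j k j' k' q M n1 : ℕ, j ≤ J → k ≤ J → j' ≤ J → k' ≤ J →
      {p : PW m (q + M) | p ∈ AS m (q + M) j k g l (g ^ n1) (l ^ (q + M)) ∧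
        p ∈ AS m (q + M) j' k' g l (g ^ (min n1 q)) (l ^ q)}.ncard ≤
      (2 * (S * (1 + q) ^ J) + 2) ^ (4 * J + 4) * 
        ((AS m M j k g l (g ^ (n1 - q)) (l ^ M)).ncard *
          (AS m q j' k' g l (g ^ (min n1 q)) (l ^ q)).ncard) := by
  obtain ⟨S1, hS1⟩ := tail_bound m g hg0 hg1 J
  obtain ⟨S2, hS2⟩ := tail_bound m l hl0 hl1 J
  refine ⟨S1 + S2 + 1, fun j k j' k' q M n1 hj hk hj' hk' => ?_⟩
  set K := (S1 + S2 + 1) * (1 + q) ^ J with hK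
  set P : Set (PW m q) := {p : PW m q |
    (∀ i ≤ j', |Jr i g (df p) - (fun _ => (0:ℝ)) i| ≤ K * g ^ (min n1 q)) ∧
      (∀ i ≤ k', |Jr i l (df p) - (fun _ => (0:ℝ)) i| ≤ K * l ^ q)} with hP
  have hPc : P.ncard ≤ (2 * K + 2) ^ (2 * J + 2) *
      (AS m q j' k' g l (g ^ (min n1 q)) (l ^ q)).ncard := by
    refine (cover_AS m q j' k' g l (g ^ (min n1 q)) (l ^ q) (by positivity) (by positivity)
      (fun _ => 0) (fun _ => 0) K).trans ?_
    gcongr <;> omega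
  have hKr : (K : ℝ) = (S1 + S2 + 1) * (1 + q) ^ J := by rw [hK]; push_cast; ring
  have hone : (1:ℝ) ≤ (1 + q) ^ J := one_le_pow₀ (by have : (0:ℝ) ≤ q := by positivity
                                                     linarith)
  have hmain := rec_split (m := m) (q := q) (M := M) {p : PW m (q + M) |
      p ∈ AS m (q + M) j k g l (g ^ n1) (l ^ (q + M)) ∧
        p ∈ AS m (q + M) j' k' g l (g ^ (min n1 q)) (l ^ q)} P
      ((2 * K + 2) ^ (2 * J + 2) * (AS m M j k g l (g ^ (n1 - q)) (l ^ M)).ncard) ?_ ?_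
  · refine hmain.trans ?_
    calc _ ≤ (2 * K + 2) ^ (2 * J + 2) * (AS m M j k g l (g ^ (n1 - q)) (l ^ M)).ncard *
          ((2 * K + 2) ^ (2 * J + 2) *
      (AS m q j' k' g l (g ^ (min n1 q)) (l ^ q)).ncard) := Nat.mul_le_mul_left _ hPc
      _ = _ := by
        rw [show 4 * J + 4 = (2 * J + 2) + (2 * J + 2) by ring, pow_add]; ring
  · -- initial part
    rintro p ⟨-, hp1, hp2⟩
    have hgen : ∀ (x : ℝ) (i : ℕ) (S n : ℕ), 0 < x → x < 1 → n ≤ q → S ≤ S1 + S2 →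
        |∑ k : Fin M, df (suf p) k * ((q : ℝ) + (k : ℕ)) ^ i * x ^ (q + (k : ℕ))| ≤
          S * (1 + q) ^ J * x ^ q → |Jr i x (df p)| ≤ x ^ n →
        |Jr i x (df (pre p)) - 0| ≤ K * x ^ n := by
      intro x i S n hx0 hx1 hn hS h1 h2
      rw [Jr_split] at h2
      rw [sub_zero, hKr]
      have h3 : x ^ q ≤ x ^ n := pow_le_pow_of_le_one hx0.le hx1.le hn
      have h4 : (S : ℝ) ≤ S1 + S2 := by exact_mod_cast hS
      have h5 : (S : ℝ) * (1 + q) ^ J * x ^ q ≤ (S1 + S2) * (1 + q) ^ J * x ^ n := by gcongr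
      have h6 : 1 * x ^ n ≤ (1 + q : ℝ) ^ J * x ^ n := by gcongr
      rw [abs_le] at h1 h2 ⊢
      constructor <;> nlinarith
    refine ⟨fun i hi => ?_, fun i hi => ?_⟩
    · exact hgen g i S1 _ hg0 hg1 (min_le_right _ _) (by omega)
        (hS1 i (hi.trans hj') M _ (abs_df_le _) q) (hp1 i hi)
    · exact hgen l i S2 _ hl0 hl1 le_rfl (by omega)
        (hS2 i (hi.trans hk') M _ (abs_df_le _) q) (hp2 i hi)
  · -- suffix
    intro π
    set cc : ℝ → ℕ → ℝ := fun x i => (x ^ q)⁻¹ * ∑ a ∈ Finset.range (i + 1),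
      ((i.choose a : ℝ) * (-(q : ℝ)) ^ (i - a)) * (- Jr a x (df π)) with hcc
    have hgen : ∀ (x : ℝ) (i j n : ℕ), 0 < x → x < 1 → q ≤ n → i ≤ j → j ≤ J →
        ∀ p : PW m (q + M), pre p = π → (∀ i ≤ j, |Jr i x (df p)| ≤ x ^ n) →
        |Jr i x (df (suf p)) - cc x i| ≤ K * x ^ (n - q) := by
      intro x i j n hx0 hx1 hn hij hj p hp h
      have := Jr_shift_bound i q x hx0 (df (suf p)) (fun a => - Jr a x (df π)) (x ^ n) ?_
      · refine this.trans ?_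
        have e : x ^ n = x ^ q * x ^ (n - q) := by rw [← pow_add]; congr 1; omega
        rw [e, inv_mul_cancel_left₀ (by positivity), hKr]
        gcongr
        have h1 : (1 + q : ℝ) ^ i ≤ (1 + q) ^ J :=
          pow_le_pow_right₀ (by have : (0:ℝ) ≤ q := by positivity
                                linarith) (hij.trans hj)
        have h2 : (1:ℝ) ≤ S1 + S2 + 1 := by
          have : (0:ℝ) ≤ S1 := by positivity
          have : (0:ℝ) ≤ S2 := by positivity
          linarith
        nlinarith
      · intro a ha
        have h1 := h a (ha.trans hij)
        rw [Jr_split, hp] at h1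
        simpa [add_comm] using h1
    by_cases hq : q ≤ n1
    · refine le_trans (Set.ncard_le_ncard ?_ (Set.toFinite _))
        (le_trans (cover_AS m M j k g l (g ^ (n1 - q)) (l ^ M) (by positivity) (by positivity)
          (cc g) (cc l) K) ?_)
      · rintro t ⟨p, ⟨⟨h1, h2⟩, -⟩, hp, rfl⟩
        refine ⟨fun i hi => ?_, fun i hi => ?_⟩
        · exact hgen g i j n1 hg0 hg1 hq hi hj p hp h1
        · have := hgen l i k (q + M) hl0 hl1 (by omega) hi hk p hp h2
          simpa using this
      · gcongr <;> omega
    · refine le_trans (Set.ncard_le_ncard ?_ (Set.toFinite _))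
        (le_trans (cover_AS m M j k g l (g ^ (n1 - q)) (l ^ M) (by positivity) (by positivity)
          (fun _ => 0) (cc l) K) ?_)
      · rintro t ⟨p, ⟨⟨h1, h2⟩, -⟩, hp, rfl⟩
        refine ⟨fun i hi => ?_, fun i hi => ?_⟩
        · have := hS1 i (hi.trans hj) M (df (suf p)) (abs_df_le _) 0
          rw [sub_zero, show n1 - q = 0 by omega, pow_zero, mul_one, hKr]
          have e : (∑ k : Fin M, df (suf p) k * (((0:ℕ) : ℝ) + (k : ℕ)) ^ i * g ^ (0 + (k : ℕ)))
              = Jr i g (df (suf p)) := by simp [Jr]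
          rw [e] at this
          simp at this
          refine this.trans ?_
          have : (0:ℝ) ≤ S1 := by positivity
          have : (0:ℝ) ≤ S2 := by positivity
          nlinarith
        · have := hgen l i k (q + M) hl0 hl1 (by omega) hi hk p hp h2
          simpa using this
      · gcongr <;> omega

/-- The polynomial `∑ a_k k^i X^k`. -/
def JP {N : ℕ} (i : ℕ) (a : Fin N → ℝ) : Polynomial ℝ :=
  ∑ k : Fin N, Polynomial.C (a k * (k : ℝ) ^ i) * Polynomial.X ^ (k : ℕ)

lemma JP_eval {N : ℕ} (i : ℕ) (a : Fin N → ℝ) (x : ℝ) : (JP i a).eval x = Jr i x a := by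
  simp [JP, Jr, Polynomial.eval_finsetSum]

lemma JP_deriv {N : ℕ} (i : ℕ) (a : Fin N → ℝ) (x : ℝ) :
    x * (JP i a).derivative.eval x = Jr (i + 1) x a := by
  simp only [JP, Jr, Polynomial.derivative_sum, Polynomial.eval_finsetSum, Finset.mul_sum]
  refine Finset.sum_congr rfl fun k _ => ?_
  simp only [Polynomial.derivative_C_mul, Polynomial.derivative_X_pow, Polynomial.eval_mul,
      Polynomial.eval_C, Polynomial.eval_pow, Polynomial.eval_X]
  rcases Nat.eq_zero_or_pos (k : ℕ) with h | h
  · simp [h]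
  · obtain ⟨n, hn⟩ : ∃ n, (k : ℕ) = n + 1 := ⟨k - 1, by omega⟩
    rw [hn]
    simp
    ring

lemma JP_deg {N : ℕ} (i : ℕ) (a : Fin N → ℝ) : (JP i a).natDegree ≤ N := by
  refine Polynomial.natDegree_sum_le_of_forall_le _ _ fun k _ => ?_
  exact (Polynomial.natDegree_C_mul_X_pow_le _ _).trans k.2.le

lemma Jr_continuous {N : ℕ} (i : ℕ) (a : Fin N → ℝ) : Continuous fun x => Jr i x a := by
  unfold Jr; fun_prop

lemma vol_good {N : ℕ} (i : ℕ) (a : Fin N → ℝ) (α τ : ℝ) (hα : 0 < α) (hτ : 0 < τ) :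
    volume {x : ℝ | x ∈ Ioo (0:ℝ) 1 ∧ |Jr i x a| ≤ α ∧ τ ≤ |Jr (i + 1) x a|} ≤
      ENNReal.ofReal ((N + 1) * (2 * α / τ)) := by
  classical
  set P := JP i a with hP
  set R := P.derivative.roots.toFinset with hR
  set c : ℝ → ℕ := fun x => (R.filter fun y => y < x).card with hc
  have hcard : R.card ≤ N := by
    refine (Multiset.toFinset_card_le _).trans ((Polynomial.card_roots' _).trans ?_)
    exact (Polynomial.natDegree_derivative_le _).trans ((Nat.sub_le _ _).trans (JP_deg i a))
  set T : ℕ → Set ℝ := fun n =>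
    {x : ℝ | x ∈ Ioo (0:ℝ) 1 ∧ |Jr i x a| ≤ α ∧ τ ≤ |Jr (i + 1) x a| ∧ c x = n} with hT
  have hsub : {x : ℝ | x ∈ Ioo (0:ℝ) 1 ∧ |Jr i x a| ≤ α ∧ τ ≤ |Jr (i + 1) x a|} ⊆
      ⋃ n ∈ Finset.range (N + 1), T n := by
    rintro x ⟨h1, h2, h3⟩
    simp only [Set.mem_iUnion]
    refine ⟨c x, ?_, h1, h2, h3, rfl⟩
    rw [Finset.mem_range, Nat.lt_succ_iff]
    exact (Finset.card_filter_le _ _).trans hcard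
  have hcm : Measurable c := by
    have : c = fun x => ∑ y ∈ R, (if y < x then 1 else 0) := by
      funext x; simp only [hc]; rw [Finset.card_filter]
    rw [this]
    refine Finset.measurable_sum _ fun y _ => ?_
    exact Measurable.ite measurableSet_Ioi measurable_const measurable_const
  have hTm : ∀ n, MeasurableSet (T n) := by
    intro n
    have m1 : MeasurableSet {x : ℝ | |Jr i x a| ≤ α} :=
      (isClosed_le (Jr_continuous i a).abs continuous_const).measurableSet
    have m2 : MeasurableSet {x : ℝ | τ ≤ |Jr (i + 1) x a|} :=
      (isClosed_le continuous_const (Jr_continuous (i + 1) a).abs).measurableSet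
    have m3 : MeasurableSet {x : ℝ | c x = n} := hcm (measurableSet_singleton n)
    exact measurableSet_Ioo.inter (m1.inter (m2.inter m3))
  have hTv : ∀ n, volume (T n) ≤ ENNReal.ofReal (2 * α / τ) := by
    intro n
    have hinj : InjOn (fun x => P.eval x) (T n) := by
      have aux : ∀ x ∈ T n, ∀ y ∈ T n, x < y → P.eval x ≠ P.eval y := by
        intro x hx y hy hxy he
        obtain ⟨z, hz, hz'⟩ := exists_hasDerivAt_eq_zero (f := fun x => P.eval x)
          (f' := fun x => P.derivative.eval x) hxy (by fun_prop) he
          (fun z _ => P.hasDerivAt z)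
        have hne : P.derivative ≠ 0 := by
          intro h0
          have := JP_deriv i a x
          rw [← hP, h0] at this
          simp at this
          have h3 := hx.2.2.1
          rw [← this] at h3
          simp at h3
          linarith
        have hzR : z ∈ R := by
          rw [hR, Multiset.mem_toFinset, Polynomial.mem_roots hne]
          exact hz'
        have : c x < c y := by
          refine Finset.card_lt_card ?_
          rw [Finset.ssubset_iff_of_subset]
          · exact ⟨z, by simp [hzR, hz.2], by simp [hz.1.le]⟩
          · intro w hw
            simp only [Finset.mem_filter] at hw ⊢
            exact ⟨hw.1, hw.2.trans hxy⟩
        have e1 := hx.2.2.2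
        have e2 := hy.2.2.2
        omega
      intro x hx y hy he
      rcases lt_trichotomy x y with h | h | h
      · exact absurd he (aux x hx y hy h)
      · exact h
      · exact absurd he.symm (aux y hy x hx h)
    have h := lintegral_image_eq_lintegral_abs_deriv_mul (hTm n)
      (f := fun x => P.eval x) (f' := fun x => P.derivative.eval x)
      (fun x _ => (P.hasDerivAt x).hasDerivWithinAt) hinj (fun _ => 1)
    simp only [mul_one, lintegral_const, MeasurableSet.univ, Measure.restrict_apply, univ_inter,
      one_mul] at h
    have h1 : volume ((fun x => P.eval x) '' T n) ≤ ENNReal.ofReal (2 * α) := by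
      have : (fun x => P.eval x) '' T n ⊆ Icc (-α) α := by
        rintro _ ⟨x, hx, rfl⟩
        have := hx.2.1
        rw [← JP_eval] at this
        exact abs_le.1 this
      refine (measure_mono this).trans ?_
      rw [Real.volume_Icc]
      apply ENNReal.ofReal_le_ofReal; linarith
    have h2 : ENNReal.ofReal τ * volume (T n) ≤
        ∫⁻ x in T n, ENNReal.ofReal |P.derivative.eval x| := by
      rw [← setLIntegral_const]
      refine setLIntegral_mono' (hTm n) fun x hx => ?_
      apply ENNReal.ofReal_le_ofReal
      have h3 := hx.2.2.1
      rw [← JP_deriv, abs_mul, abs_of_pos hx.1.1] at h3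
      refine h3.trans ?_
      have := hx.1.2
      have := abs_nonneg (P.derivative.eval x)
      rw [← hP]
      nlinarith
    have h3 : ENNReal.ofReal τ * volume (T n) ≤ ENNReal.ofReal (2 * α) := by
      refine h2.trans (le_trans (le_of_eq ?_) h1)
      rw [← h]
    rw [ENNReal.ofReal_div_of_pos hτ, ENNReal.le_div_iff_mul_le
      (Or.inl (by simpa using hτ)) (Or.inl (by simp)), mul_comm]
    exact h3
  calc _ ≤ volume (⋃ n ∈ Finset.range (N + 1), T n) := measure_mono hsub
    _ ≤ ∑ n ∈ Finset.range (N + 1), volume (T n) := measure_biUnion_finset_le _ _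
    _ ≤ ∑ n ∈ Finset.range (N + 1), ENNReal.ofReal (2 * α / τ) :=
        Finset.sum_le_sum fun n _ => hTv n
    _ = _ := by
        rw [Finset.sum_const, Finset.card_range, nsmul_eq_mul,
          ENNReal.ofReal_mul (by positivity)]
        congr 1
        rw [ENNReal.ofReal_add (by positivity) (by norm_num)]
        simp

/-- The transversality condition at scale `r`, `r'` (vacuous if `r < r'`). -/
def GC (i r r' : ℕ) (x : ℝ) {N : ℕ} (a : Fin N → ℝ) : Prop :=
  r < r' ∨ (|Jr i x a| ≤ (1 / 2) ^ r ∧ (1 / 2) ^ r' ≤ |Jr (i + 1) x a|)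

lemma vol_GC (i r r' : ℕ) {N : ℕ} (a : Fin N → ℝ) :
    volume {x : ℝ | x ∈ Ioo (0:ℝ) 1 ∧ GC i r r' x a} ≤
      ENNReal.ofReal (2 * (N + 1) * (1 / 2) ^ (r - r')) := by
  by_cases h : r < r'
  · have : {x : ℝ | x ∈ Ioo (0:ℝ) 1 ∧ GC i r r' x a} ⊆ Ioo 0 1 := fun x hx => hx.1
    refine (measure_mono this).trans ?_
    rw [Real.volume_Ioo, show r - r' = 0 by omega]
    apply ENNReal.ofReal_le_ofReal
    have : (0:ℝ) ≤ N := by positivity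
    simp; linarith
  · have : {x : ℝ | x ∈ Ioo (0:ℝ) 1 ∧ GC i r r' x a} =
        {x : ℝ | x ∈ Ioo (0:ℝ) 1 ∧ |Jr i x a| ≤ (1 / 2) ^ r ∧ (1 / 2) ^ r' ≤ |Jr (i + 1) x a|} := by
      ext x; simp [GC, h]
    rw [this]
    refine (vol_good i a ((1 / 2) ^ r) ((1 / 2) ^ r') (by positivity) (by positivity)).trans ?_
    apply ENNReal.ofReal_le_ofReal
    have e : (1 / 2 : ℝ) ^ r = (1 / 2) ^ r' * (1 / 2) ^ (r - r') := by
      rw [← pow_add]; congr 1; omega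
    rw [e]
    apply le_of_eq
    field_simp

lemma meas_GC (i r r' : ℕ) {N : ℕ} (a : Fin N → ℝ) : MeasurableSet {x : ℝ | GC i r r' x a} := by
  have m1 : MeasurableSet {x : ℝ | |Jr i x a| ≤ (1 / 2) ^ r} :=
    (isClosed_le (Jr_continuous i a).abs continuous_const).measurableSet
  have m2 : MeasurableSet {x : ℝ | (1 / 2) ^ r' ≤ |Jr (i + 1) x a|} :=
    (isClosed_le continuous_const (Jr_continuous (i + 1) a).abs).measurableSet
  exact (MeasurableSet.const _).union (m1.inter m2)

/-- Pairs of words satisfying both transversality conditions. -/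
def GS (m N j k r1 r1' r2 r2' : ℕ) (g l : ℝ) : Set (PW m N) :=
  {p | GC j r1 r1' g (df p) ∧ GC k r2 r2' l (df p)}

lemma GS_eq (m N j k r1 r1' r2 r2' : ℕ) (z : ℝ × ℝ) :
    ((GS m N j k r1 r1' r2 r2' z.1 z.2).ncard : ℝ≥0∞) = ∑ p : PW m N,
      ({x : ℝ | GC j r1 r1' x (df p)} ×ˢ {x : ℝ | GC k r2 r2' x (df p)}).indicator
        (fun _ => (1:ℝ≥0∞)) z := by
  classical
  have e : (GS m N j k r1 r1' r2 r2' z.1 z.2).toFinset = Finset.univ.filter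
      (fun p => p ∈ GS m N j k r1 r1' r2 r2' z.1 z.2) := by ext; simp
  rw [Set.ncard_eq_toFinset_card', e, Finset.card_filter]
  push_cast
  refine Finset.sum_congr rfl fun p _ => ?_
  rw [Set.indicator_apply]
  refine if_congr ?_ rfl rfl
  rfl

lemma int_GS (m N j k r1 r1' r2 r2' : ℕ) :
    ∫⁻ z in (Ioo (0:ℝ) 1 ×ˢ Ioo (0:ℝ) 1), ((GS m N j k r1 r1' r2 r2' z.1 z.2).ncard : ℝ≥0∞) ≤
      ENNReal.ofReal ((m : ℝ) ^ (2 * N) *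
        (4 * (N + 1) ^ 2 * ((1 / 2) ^ (r1 - r1') * (1 / 2) ^ (r2 - r2')))) := by
  simp only [GS_eq]
  rw [lintegral_finsetSum]
  · calc _ ≤ ∑ p : PW m N, ENNReal.ofReal
          (4 * (N + 1) ^ 2 * ((1 / 2) ^ (r1 - r1') * (1 / 2) ^ (r2 - r2'))) := by
          refine Finset.sum_le_sum fun p _ => ?_
          rw [lintegral_indicator ((meas_GC _ _ _ _).prod (meas_GC _ _ _ _))]
          rw [setLIntegral_const, one_mul, Measure.restrict_apply
            ((meas_GC _ _ _ _).prod (meas_GC _ _ _ _)), Set.prod_inter_prod,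
            Measure.volume_eq_prod, Measure.prod_prod]
          have e1 := vol_GC j r1 r1' (df p)
          have e2 := vol_GC k r2 r2' (df p)
          have h1 : {x : ℝ | GC j r1 r1' x (df p)} ∩ Ioo 0 1 =
            {x : ℝ | x ∈ Ioo (0:ℝ) 1 ∧ GC j r1 r1' x (df p)} := by ext; simp [and_comm]
          have h2 : {x : ℝ | GC k r2 r2' x (df p)} ∩ Ioo 0 1 =
            {x : ℝ | x ∈ Ioo (0:ℝ) 1 ∧ GC k r2 r2' x (df p)} := by ext; simp [and_comm]
          rw [h1, h2]
          refine (mul_le_mul' e1 e2).trans ?_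
          rw [← ENNReal.ofReal_mul (by positivity)]
          apply ENNReal.ofReal_le_ofReal
          apply le_of_eq; ring
      _ = _ := by
          rw [Finset.sum_const, nsmul_eq_mul]
          have e : ((Finset.univ : Finset (PW m N)).card : ℝ≥0∞) =
              ENNReal.ofReal ((m : ℝ) ^ (2 * N)) := by
            rw [ENNReal.ofReal_pow (by positivity), ENNReal.ofReal_natCast]
            simp [← pow_add, ← two_mul]
          rw [e, ← ENNReal.ofReal_mul (by positivity)]
  · intro p _
    exact measurable_const.indicator ((meas_GC _ _ _ _).prod (meas_GC _ _ _ _))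

lemma ae_GS (m : ℕ) (hm : 0 < m) (j k : ℕ) : ∀ᵐ z : ℝ × ℝ ∂volume,
    z ∈ (Ioo (0:ℝ) 1 ×ˢ Ioo (0:ℝ) 1) → ∃ C : ℝ, 0 ≤ C ∧ ∀ N r1 r1' r2 r2' : ℕ,
      ((GS m N j k r1 r1' r2 r2' z.1 z.2).ncard : ℝ) ≤
        C * ((m : ℝ) ^ (2 * N) * (4 * (N + 1) ^ 2 * ((1 / 2) ^ (r1 - r1') * (1 / 2) ^ (r2 - r2')))
          * (((N:ℝ) + 1) ^ 2 * (((r1:ℝ) + 1) ^ 2 * (((r1':ℝ) + 1) ^ 2 * (((r2:ℝ) + 1) ^ 2 *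
            ((r2':ℝ) + 1) ^ 2))))) := by
  set v : ℕ × ℕ × ℕ × ℕ × ℕ → ℝ := fun I => (m : ℝ) ^ (2 * I.1) *
    (4 * (I.1 + 1) ^ 2 * ((1 / 2) ^ (I.2.1 - I.2.2.1) * (1 / 2) ^ (I.2.2.2.1 - I.2.2.2.2))) with hv
  set w : ℕ × ℕ × ℕ × ℕ × ℕ → ℝ := fun I => (((I.1:ℝ) + 1) ^ 2)⁻¹ * ((((I.2.1:ℝ) + 1) ^ 2)⁻¹ *
    ((((I.2.2.1:ℝ) + 1) ^ 2)⁻¹ * ((((I.2.2.2.1:ℝ) + 1) ^ 2)⁻¹ *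
            (((I.2.2.2.2:ℝ) + 1) ^ 2)⁻¹))) with hw
  have hv0 : ∀ I, 0 < v I := fun I => by simp only [hv]; positivity
  have hw0 : ∀ I, 0 < w I := fun I => by simp only [hw]; positivity
  have hs1 : Summable fun n : ℕ => (((n:ℝ) + 1) ^ 2)⁻¹ := by
    have := (summable_nat_add_iff 1).2 (Real.summable_nat_pow_inv.2 (by norm_num : 1 < 2))
    simpa using this
  have hws : Summable w := by
    have p1 : ∀ n : ℕ, 0 ≤ (((n:ℝ) + 1) ^ 2)⁻¹ := fun n => by positivity
    refine hs1.mul_of_nonneg (hs1.mul_of_nonneg (hs1.mul_of_nonneg (hs1.mul_of_nonneg hs1 p1 p1)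
      p1 ?_) p1 ?_) p1 ?_ <;> · intro I; simp only [Pi.zero_apply]; positivity
  set F : ℕ × ℕ × ℕ × ℕ × ℕ → ℝ × ℝ → ℝ≥0∞ := fun I z =>
    ((GS m I.1 j k I.2.1 I.2.2.1 I.2.2.2.1 I.2.2.2.2 z.1 z.2).ncard : ℝ≥0∞) *
      ENNReal.ofReal ((v I)⁻¹ * w I) with hF
  have hmeas : ∀ I, Measurable (F I) := by
    intro I
    simp only [hF, GS_eq]
    refine Measurable.mul_const (Finset.measurable_sum _ fun p _ => ?_) _
    exact measurable_const.indicator ((meas_GC _ _ _ _).prod (meas_GC _ _ _ _))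
  have hIntg : ∫⁻ z in (Ioo (0:ℝ) 1 ×ˢ Ioo (0:ℝ) 1), ∑' I, F I z ≠ ∞ := by
    rw [lintegral_tsum fun I => (hmeas I).aemeasurable]
    refine ne_top_of_le_ne_top hws.tsum_ofReal_ne_top (ENNReal.tsum_le_tsum fun I => ?_)
    simp only [hF]
    rw [lintegral_mul_const' _ _ ENNReal.ofReal_ne_top]
    refine (mul_le_mul_left (int_GS _ _ _ _ _ _ _ _) _).trans ?_
    change ENNReal.ofReal (v I) * _ ≤ _
    rw [← ENNReal.ofReal_mul (hv0 I).le, mul_inv_cancel_left₀ (hv0 I).ne']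
  have hae := ae_lt_top' (Measurable.aemeasurable (by
    exact Measurable.tsum hmeas)) hIntg
  rw [ae_restrict_iff' (measurableSet_Ioo.prod measurableSet_Ioo)] at hae
  filter_upwards [hae] with z hz hzm
  have hz' := hz hzm
  refine ⟨(∑' I, F I z).toReal, ENNReal.toReal_nonneg, fun N r1 r1' r2 r2' => ?_⟩
  set I : ℕ × ℕ × ℕ × ℕ × ℕ := (N, r1, r1', r2, r2') with hI
  have h1 : F I z ≤ ∑' I, F I z := ENNReal.le_tsum I
  have h2 := ENNReal.toReal_mono hz'.ne h1
  simp only [hF] at h2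
  rw [ENNReal.toReal_mul, ENNReal.toReal_ofReal (by have := hv0 I; have := hw0 I; positivity),
    ENNReal.toReal_natCast] at h2
  have h3 : ((GS m N j k r1 r1' r2 r2' z.1 z.2).ncard : ℝ) ≤
      (∑' I, F I z).toReal * (v I * (w I)⁻¹) := by
    have := hv0 I; have := hw0 I
    have e : ((GS m N j k r1 r1' r2 r2' z.1 z.2).ncard : ℝ) =
      (((GS m N j k r1 r1' r2 r2' z.1 z.2).ncard : ℝ) * ((v I)⁻¹ * w I)) * (v I * (w I)⁻¹) := by
      field_simp
    rw [e]
    exact mul_le_mul_of_nonneg_right h2 (by positivity)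
  refine h3.trans (le_of_eq ?_)
  simp only [hv, hw, hI, mul_inv, inv_inv]

/-- infinite version of `Jr` -/
def Js (i : ℕ) (x : ℝ) (a : ℕ → ℝ) : ℝ := ∑' k : ℕ, a k * (k : ℝ) ^ i * x ^ k

lemma Js_bound (i : ℕ) (x : ℝ) (hx0 : 0 < x) (m : ℝ) (a : ℕ → ℝ) (ha : ∀ k, |a k| ≤ m) (k : ℕ) :
    ‖a k * (k : ℝ) ^ i * x ^ k‖ ≤ m * ((k:ℝ) ^ i * x ^ k) := by
  rw [mul_assoc, norm_mul, Real.norm_eq_abs, Real.norm_eq_abs (_ * _),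
    abs_of_nonneg (by positivity : (0:ℝ) ≤ (k:ℝ) ^ i * x ^ k)]
  exact mul_le_mul_of_nonneg_right (ha k) (by positivity)

lemma summ_poly (i : ℕ) (x : ℝ) (hx0 : 0 < x) (hx1 : x < 1) (m : ℝ) :
    Summable fun k : ℕ => m * ((k:ℝ) ^ i * x ^ k) :=
  (summable_pow_mul_geometric_of_norm_lt_one i (by
    rw [Real.norm_eq_abs, abs_of_pos hx0]; exact hx1)).mul_left m

/-- If all the moments vanish then the first coefficient vanishes. -/
lemma Js_zero (x : ℝ) (hx0 : 0 < x) (hx1 : x < 1) (m : ℝ) (a : ℕ → ℝ) (ha : ∀ k, |a k| ≤ m)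
    (h : ∀ i, Js i x a = 0) : a 0 = 0 := by
  -- vanishing near x
  have hnear : ∀ t : ℝ, |t| < -Real.log x → ∑' k : ℕ, a k * (x * Real.exp t) ^ k = 0 := by
    intro t ht
    have hs1 : ∀ k : ℕ, HasSum (fun i : ℕ => a k * x ^ k * (((k:ℝ) * t) ^ i / (i.factorial : ℝ)))
        (a k * (x * Real.exp t) ^ k) := by
      intro k
      have := NormedSpace.expSeries_div_hasSum_exp ((k:ℝ) * t)
      rw [← Real.exp_eq_exp_ℝ] at this
      have := this.mul_left (a k * x ^ k)
      have e : a k * (x * Real.exp t) ^ k = a k * x ^ k * Real.exp ((k:ℝ) * t) := by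
        rw [mul_pow, ← Real.exp_nat_mul]; ring
      rw [e]; exact this
    have hs2 : ∀ k : ℕ, HasSum (fun i : ℕ => |a k * x ^ k * (((k:ℝ) * t) ^ i / (i.factorial : ℝ))|)
        (|a k| * (x * Real.exp |t|) ^ k) := by
      intro k
      have := NormedSpace.expSeries_div_hasSum_exp ((k:ℝ) * |t|)
      rw [← Real.exp_eq_exp_ℝ] at this
      have := this.mul_left (|a k| * x ^ k)
      have e : |a k| * (x * Real.exp |t|) ^ k = |a k| * x ^ k * Real.exp ((k:ℝ) * |t|) := by
        rw [mul_pow, ← Real.exp_nat_mul]; ring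
      have e2 : (fun i : ℕ => |a k * x ^ k * (((k:ℝ) * t) ^ i / (i.factorial : ℝ))|) =
          fun i : ℕ => |a k| * x ^ k * (((k:ℝ) * |t|) ^ i / (i.factorial : ℝ)) := by
        ext i
        rw [abs_mul, abs_mul, abs_div, abs_of_pos (pow_pos hx0 k), abs_pow, abs_mul]
        simp
      rw [e, e2]; exact this
    have hlt : x * Real.exp |t| < 1 := by
      have : Real.exp |t| < Real.exp (-Real.log x) := Real.exp_lt_exp.2 ht
      rw [Real.exp_neg, Real.exp_log hx0] at this
      calc x * Real.exp |t| < x * x⁻¹ := mul_lt_mul_of_pos_left this hx0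
        _ = 1 := mul_inv_cancel₀ hx0.ne'
    have hS : Summable (Function.uncurry fun (k i : ℕ) =>
        a k * x ^ k * (((k:ℝ) * t) ^ i / (i.factorial : ℝ))) := by
      apply Summable.of_abs
      rw [summable_prod_of_nonneg (fun _ => abs_nonneg _)]
      refine ⟨fun k => (hs2 k).summable, ?_⟩
      simp only [Function.uncurry]
      have : (fun k : ℕ => ∑' i : ℕ, |a k * x ^ k * (((k:ℝ) * t) ^ i / (i.factorial : ℝ))|) =
        fun k : ℕ => |a k| * (x * Real.exp |t|) ^ k := by
        ext k; exact (hs2 k).tsum_eq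
      rw [this]
      refine Summable.of_nonneg_of_le (fun k => by positivity)
        (fun k => mul_le_mul_of_nonneg_right (ha k) (by positivity))
        ((summable_geometric_of_lt_one (by positivity) hlt).mul_left m)
    have hc := hS.tsum_comm
    have e1 : ∀ k : ℕ, ∑' i : ℕ, a k * x ^ k * (((k:ℝ) * t) ^ i / (i.factorial : ℝ)) =
      a k * (x * Real.exp t) ^ k := fun k => (hs1 k).tsum_eq
    have e2 : ∀ i : ℕ, ∑' k : ℕ, a k * x ^ k * (((k:ℝ) * t) ^ i / (i.factorial : ℝ)) = 0 := by
      intro i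
      have : ∀ k : ℕ, a k * x ^ k * (((k:ℝ) * t) ^ i / (i.factorial : ℝ)) =
        (t ^ i / (i.factorial : ℝ)) * (a k * (k:ℝ) ^ i * x ^ k) := by
        intro k; rw [mul_pow]; ring
      simp_rw [this]
      rw [tsum_mul_left]
      have := h i
      rw [Js] at this
      rw [this, mul_zero]
    simp_rw [e1, e2] at hc
    simpa using hc.symm
  set p := FormalMultilinearSeries.ofScalars ℝ a with hp
  have hrad : 1 ≤ p.radius := by
    have := p.le_radius_of_bound (r := 1) m (fun n => by
      simp only [hp, FormalMultilinearSeries.ofScalars_norm]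
      simpa using ha n)
    simpa using this
  have hball := p.hasFPowerSeriesOnBall (lt_of_lt_of_le one_pos hrad)
  have hsum : ∀ y : ℝ, p.sum y = ∑' k : ℕ, a k * y ^ k := by
    intro y
    have := FormalMultilinearSeries.ofScalars_sum_eq a y
    rw [FormalMultilinearSeries.ofScalarsSum] at this
    simpa [smul_eq_mul] using this
  have hana : AnalyticOnNhd ℝ p.sum (Metric.ball 0 1) := by
    refine hball.analyticOnNhd.mono ?_
    rw [← Metric.eball_ofReal] 
    exact Metric.eball_subset_eball (by simpa using hrad)
  have hx : x ∈ Metric.ball (0:ℝ) 1 := by simp [abs_of_pos hx0, hx1]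
  have hev : p.sum =ᶠ[𝓝 x] 0 := by
    have hcont : ContinuousAt (fun y => |Real.log (y / x)|) x := by
      refine ContinuousAt.abs (ContinuousAt.log (by fun_prop) ?_)
      rw [div_self hx0.ne']; norm_num
    have h1 : ∀ᶠ y in 𝓝 x, |Real.log (y / x)| < -Real.log x := by
      apply hcont.eventually_lt continuousAt_const
      rw [div_self hx0.ne']
      simpa using Real.log_neg hx0 hx1
    filter_upwards [h1, lt_mem_nhds hx0] with y hy hy0
    have := hnear _ hy
    rw [Real.exp_log (by positivity), mul_div_cancel₀ _ hx0.ne'] at this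
    rw [hsum, this]; rfl
  have := hana.eqOn_zero_of_preconnected_of_eventuallyEq_zero
    (convex_ball (0:ℝ) 1).isPreconnected hx hev
  have h0 := this (Metric.mem_ball_self one_pos : (0:ℝ) ∈ Metric.ball (0:ℝ) 1)
  rw [hsum, tsum_eq_single 0 (fun k hk => by simp [hk])] at h0
  simpa using h0

lemma base_compact (m : ℕ) (x : ℝ) (hx0 : 0 < x) (hx1 : x < 1) :
    ∃ (J : ℕ) (r : ℝ), 0 < r ∧ ∀ a : ℕ → ℝ, (∀ k, |a k| ≤ m) → 1 ≤ |a 0| →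
      ∃ i ≤ J, r < |Js i x a| := by
  by_contra! hcon
  set X : Set (ℕ → ℝ) := (Set.univ.pi fun _ => Icc (-(m:ℝ)) m) ∩ {a | 1 ≤ |a 0|} with hX
  have hXm : ∀ a ∈ X, ∀ k, |a k| ≤ m := fun a ha k => abs_le.2 (ha.1 k (mem_univ k))
  have hXc : IsCompact X := (isCompact_univ_pi fun _ => isCompact_Icc).inter_right
    (isClosed_le continuous_const (continuous_apply 0).abs)
  have hcont : ∀ i, ContinuousOn (Js i x) X := by
    intro i
    refine continuousOn_tsum (u := fun k : ℕ => m * ((k:ℝ) ^ i * x ^ k)) ?_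
      (summ_poly i x hx0 hx1 m) ?_
    · intro k; fun_prop
    · intro k a ha; exact Js_bound i x hx0 m a (hXm a ha) k
  set Cn : ℕ → Set (ℕ → ℝ) := fun n => {a | a ∈ X ∧ ∀ i ≤ n, |Js i x a| ≤ 1 / ((n:ℝ) + 1)} with hCn
  have hclosed : ∀ n, IsClosed (Cn n) := by
    intro n
    have : Cn n = ⋂ i : ℕ, (X ∩ {a | i ≤ n → |Js i x a| ≤ 1 / ((n:ℝ) + 1)}) := by
      ext a; simp only [hCn, mem_ofPred_eq, mem_iInter, mem_inter_iff]
      exact ⟨fun h i => ⟨h.1, h.2 i⟩, fun h => ⟨(h 0).1, fun i => (h i).2⟩⟩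
    rw [this]
    refine isClosed_iInter fun i => ?_
    by_cases hi : i ≤ n
    · have := (hcont i).abs.preimage_isClosed_of_isClosed hXc.isClosed
        (isClosed_Iic (a := 1 / ((n:ℝ) + 1)))
      simpa [hi, Set.preimage] using this
    · simpa [hi] using hXc.isClosed
  have hne := IsCompact.nonempty_iInter_of_sequence_nonempty_isCompact_isClosed Cn
    (fun n a ha => ⟨ha.1, fun i hi => (ha.2 i (by omega)).trans (by
      push_cast
      exact one_div_le_one_div_of_le (by positivity) (by linarith))⟩)
    (fun n => by
      obtain ⟨a, h1, h2, h3⟩ := hcon n (1 / ((n:ℝ) + 1)) (by positivity)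
      exact ⟨a, ⟨fun k _ => abs_le.1 (h1 k), h2⟩, h3⟩)
    (hXc.of_isClosed_subset (hclosed 0) fun a ha => ha.1) hclosed
  obtain ⟨a, ha⟩ := hne
  rw [mem_iInter] at ha
  have haX := (ha 0).1
  have hz : ∀ i, Js i x a = 0 := by
    intro i
    by_contra hne
    have hpos : 0 < |Js i x a| := abs_pos.2 hne
    obtain ⟨n, hn⟩ := exists_nat_one_div_lt hpos
    have h1 := (ha (max i n)).2 i (le_max_left _ _)
    have h2 : 1 / (((max i n : ℕ):ℝ) + 1) ≤ 1 / ((n:ℝ) + 1) :=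
      one_div_le_one_div_of_le (by positivity) (by
        have : (n:ℝ) ≤ ((max i n : ℕ):ℝ) := by exact_mod_cast le_max_right i n
        linarith)
    linarith
  have := Js_zero x hx0 hx1 m a (hXm a haX) hz
  have h1 : 1 ≤ |a 0| := haX.2
  rw [this] at h1
  norm_num at h1

lemma base_fin (m : ℕ) (x : ℝ) (hx0 : 0 < x) (hx1 : x < 1) :
    ∃ (J : ℕ) (r : ℝ), 0 < r ∧ ∀ (N : ℕ) (a : Fin (N + 1) → ℝ), (∀ k, |a k| ≤ m) → 1 ≤ |a 0| →
      ∃ i ≤ J, r < |Jr i x a| := by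
  obtain ⟨J, r, hr, H⟩ := base_compact m x hx0 hx1
  refine ⟨J, r, hr, fun N a ha h0 => ?_⟩
  obtain ⟨b, hb1, hb2⟩ : ∃ b : ℕ → ℝ, (∀ k : Fin (N + 1), b k = a k) ∧
      ∀ k, ¬ k < N + 1 → b k = 0 :=
    ⟨fun k => if h : k < N + 1 then a ⟨k, h⟩ else 0, fun k => dif_pos k.2, fun k h => dif_neg h⟩
  obtain ⟨i, hi, h⟩ := H b (fun k => by
    by_cases h : k < N + 1
    · have := hb1 ⟨k, h⟩
      simp only at this
      rw [this]; exact ha _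
    · rw [hb2 k h]; simp) (by have := hb1 0; simp only [Fin.coe_ofNat_eq_mod, Nat.zero_mod] at this; rw [this]; exact h0)
  refine ⟨i, hi, ?_⟩
  convert h using 2
  rw [Js, Jr, tsum_eq_sum (s := Finset.range (N + 1)), Finset.sum_range]
  · refine Finset.sum_congr rfl fun k _ => by rw [hb1]
  · intro k hk
    have : ¬ k < N + 1 := by simpa using hk
    rw [hb2 k this]; simp

lemma poly_exp (K : ℕ) (ζ : ℝ) (hζ : 1 < ζ) : ∃ C : ℝ, 0 < C ∧ ∀ n : ℕ, ((n:ℝ) + 1) ^ K ≤ C * ζ ^ n := by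
  have h := tendsto_pow_const_div_const_pow_of_one_lt K hζ
  have h1 := (tendsto_add_atTop_iff_nat 1).2 h
  obtain ⟨B, hB⟩ := h1.bddAbove_range
  have hB' : ∀ n : ℕ, ((n:ℝ) + 1) ^ K / ζ ^ (n + 1) ≤ B := fun n => by
    have := hB ⟨n, rfl⟩
    push_cast at this; exact this
  have hBpos : 0 < B := lt_of_lt_of_le (by positivity) (hB' 0)
  refine ⟨B * ζ, by positivity, fun n => ?_⟩
  have := hB' n
  rw [div_le_iff₀ (by positivity)] at this
  calc _ ≤ _ := this
    _ = _ := by rw [pow_succ]; ring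

lemma card_PW (m N : ℕ) (S : Set (PW m N)) : S.ncard ≤ m ^ (2 * N) := by
  refine (Set.ncard_le_ncard (Set.subset_univ S) (Set.toFinite _)).trans ?_
  rw [Set.ncard_univ]
  simp [Nat.card_eq_fintype_card, two_mul, pow_add]

lemma diag_count (m q M : ℕ) :
    {p : PW m (q + M) | (pre p).1 = (pre p).2}.ncard ≤ m ^ (2 * M) * m ^ q := by
  have h := rec_split {p : PW m (q + M) | (pre p).1 = (pre p).2} {p : PW m q | p.1 = p.2}
    (m ^ (2 * M)) (fun p hp => hp) (fun π => card_PW m M _)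
  refine h.trans (Nat.mul_le_mul_left _ ?_)
  have : {p : PW m q | p.1 = p.2} ⊆ (fun u => (u, u)) '' (Set.univ : Set (Fin q → Fin m)) := by
    rintro ⟨u, v⟩ h
    exact ⟨u, trivial, by simpa using h⟩
  refine (Set.ncard_le_ncard this (Set.toFinite _)).trans ((Set.ncard_image_le (Set.toFinite _)).trans ?_)
  rw [Set.ncard_univ]
  simp [Nat.card_eq_fintype_card]

lemma base_count (m : ℕ) (hm : 2 ≤ m) (x : ℝ) (hx0 : 0 < x) (hx1 : x < 1) : ∃ J : ℕ, ∀ ζ : ℝ, 1 < ζ →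
    ∃ C : ℝ, 0 < C ∧ ∀ N : ℕ, ({p : PW m N | ∀ i ≤ J, |Jr i x (df p)| ≤ x ^ N}.ncard : ℝ) ≤
      C * ζ ^ N * (m:ℝ) ^ N := by
  obtain ⟨J, r, hr, H⟩ := base_fin m x hx0 hx1
  refine ⟨J, fun ζ hζ => ?_⟩
  have hm0 : (0:ℝ) < m := by exact_mod_cast (by omega : 0 < m)
  have hm1 : (1:ℝ) ≤ m := by exact_mod_cast (by omega : 1 ≤ m)
  obtain ⟨κ, hκ⟩ := exists_pow_lt_of_lt_one (by positivity : (0:ℝ) < (m:ℝ)⁻¹) hx1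
  obtain ⟨C, hC, hCn⟩ := poly_exp (J * κ + 1) ζ hζ
  refine ⟨C * (1 + (r⁻¹) ^ κ), by positivity, fun N => ?_⟩
  set R : ℝ := ((1 + (N:ℝ)) ^ J * r⁻¹) ^ κ with hR
  have hR0 : 0 ≤ R := by positivity
  set E : ℕ → Set (PW m N) := fun q =>
    {p | q ≤ N ∧ (∀ k : Fin N, (k:ℕ) < q → p.1 k = p.2 k) ∧ (m:ℝ) ^ (N - q) ≤ 1 + R} with hE
  have hEc : ∀ q ∈ Finset.range (N + 1), ((E q).ncard : ℝ) ≤ (m:ℝ) ^ N * (1 + R) := by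
    intro q hq
    by_cases hb : (m:ℝ) ^ (N - q) ≤ 1 + R
    · have hqN : q ≤ N := by simpa [Nat.lt_succ_iff] using hq
      have : (E q).ncard ≤ m ^ (2 * (N - q)) * m ^ q := by
        obtain ⟨M, rfl⟩ := Nat.exists_eq_add_of_le hqN
        rw [Nat.add_sub_cancel_left]
        refine le_trans (Set.ncard_le_ncard ?_ (Set.toFinite _)) (diag_count m q M)
        intro p hp
        change (pre p).1 = (pre p).2
        ext k : 1
        exact hp.2.1 (Fin.castAdd M k) (by simp)
      calc ((E q).ncard : ℝ) ≤ (m:ℝ) ^ (2 * (N - q)) * (m:ℝ) ^ q := by exact_mod_cast this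
        _ = (m:ℝ) ^ N * (m:ℝ) ^ (N - q) := by
            rw [← pow_add, ← pow_add]; congr 1; omega
        _ ≤ _ := by gcongr
    · have : E q = ∅ := by
        ext p; simp only [hE, mem_ofPred_eq, mem_empty_iff_false, iff_false]; tauto
      rw [this]; simp; positivity
  have hsub : {p : PW m N | ∀ i ≤ J, |Jr i x (df p)| ≤ x ^ N} ⊆ ⋃ q ∈ Finset.range (N + 1), E q := by
    intro p hp
    simp only [mem_iUnion, Finset.mem_range]
    by_cases hd : ∀ k, p.1 k = p.2 k
    · exact ⟨N, by omega, le_rfl, fun k _ => hd k, by simpa using hR0⟩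
    · push Not at hd
      obtain ⟨k0, hk0⟩ := hd
      have hex : ∃ q : ℕ, ∃ h : q < N, p.1 ⟨q, h⟩ ≠ p.2 ⟨q, h⟩ := ⟨k0, k0.2, hk0⟩
      classical
      obtain ⟨hqN, hqne⟩ := Nat.find_spec hex
      have hmin : ∀ k : Fin N, (k:ℕ) < Nat.find hex → p.1 k = p.2 k := by
        intro k hk
        have := Nat.find_min hex hk
        push Not at this
        exact this k.2
      generalize Nat.find hex = q at hqN hqne hmin
      refine ⟨q, by omega, hqN.le, hmin, ?_⟩
      obtain ⟨M, hM⟩ := Nat.exists_eq_add_of_lt hqN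
      rw [add_assoc] at hM
      subst hM
      have hpre : ∀ i, Jr i x (df (pre p)) = 0 := by
        intro i
        rw [Jr]
        refine Finset.sum_eq_zero fun k _ => ?_
        have := hmin (Fin.castAdd (M + 1) k) (by simp)
        simp [df, dg, pre, this]
      obtain ⟨i, hi, hlt⟩ := H M (df (suf p)) (abs_df_le _) (by
        have hne : ((p.1 ⟨q, hqN⟩ : ℕ) : ℤ) - ((p.2 ⟨q, hqN⟩ : ℕ) : ℤ) ≠ 0 := by
          intro h; apply hqne; ext; omega
        have h1 := Int.one_le_abs hne
        have h2 : (1:ℝ) ≤ |(((p.1 ⟨q, hqN⟩ : ℕ) : ℝ) - ((p.2 ⟨q, hqN⟩ : ℕ) : ℝ))| := by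
          exact_mod_cast h1
        exact h2)
      have hb := Jr_shift_bound i q x hx0 (df (suf p)) (fun _ => 0) (x ^ (q + (M + 1))) (fun l hl => by
        have h1 := hp l (hl.trans hi)
        rw [Jr_split, hpre, zero_add] at h1
        simpa using h1)
      simp only [mul_zero, Finset.sum_const_zero, sub_zero] at hb
      have hq1 : (1 + (q:ℝ)) ^ i ≤ (1 + ((q + (M + 1) : ℕ) : ℝ)) ^ J := by
        calc (1 + (q:ℝ)) ^ i ≤ (1 + (q:ℝ)) ^ J := pow_le_pow_right₀ (by
              have : (0:ℝ) ≤ q := by positivity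
              linarith) hi
          _ ≤ _ := by gcongr
      have hx3 : (x ^ q)⁻¹ * x ^ (q + (M + 1)) = x ^ (M + 1) := by
        rw [pow_add]; field_simp
      rw [hx3] at hb
      have h4 : r < (1 + ((q + (M + 1) : ℕ) : ℝ)) ^ J * x ^ (M + 1) :=
        hlt.trans_le (hb.trans (by gcongr))
      rw [Nat.add_sub_cancel_left]
      have h5 : (x ^ (M + 1))⁻¹ ≤ (1 + ((q + (M + 1) : ℕ) : ℝ)) ^ J * r⁻¹ := by
        rw [inv_le_iff_one_le_mul₀ (by positivity), mul_right_comm, ← div_eq_mul_inv, le_div_iff₀ hr]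
        linarith
      have h6 : (m:ℝ) ≤ (x ^ κ)⁻¹ := by
        rw [le_inv_comm₀ hm0 (by positivity)]; exact hκ.le
      have h7 : (m:ℝ) ^ (M + 1) ≤ R := by
        calc (m:ℝ) ^ (M + 1) ≤ ((x ^ κ)⁻¹) ^ (M + 1) := by gcongr
          _ = ((x ^ (M + 1))⁻¹) ^ κ := by
              rw [inv_pow, inv_pow, ← pow_mul, ← pow_mul, mul_comm]
          _ ≤ _ := by rw [hR]; gcongr
      linarith
  have hcard : ({p : PW m N | ∀ i ≤ J, |Jr i x (df p)| ≤ x ^ N}.ncard : ℝ) ≤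
      ∑ q ∈ Finset.range (N + 1), ((E q).ncard : ℝ) := by
    have h1 := Set.ncard_le_ncard hsub (Set.toFinite _)
    have h2 := Finset.set_ncard_biUnion_le (Finset.range (N + 1)) E
    exact_mod_cast h1.trans h2
  have hN : (0:ℝ) ≤ N := by positivity
  calc _ ≤ _ := hcard
    _ ≤ ∑ q ∈ Finset.range (N + 1), (m:ℝ) ^ N * (1 + R) := Finset.sum_le_sum hEc
    _ = (m:ℝ) ^ N * (((N:ℝ) + 1) * (1 + R)) := by simp; ring
    _ ≤ (m:ℝ) ^ N * (((N:ℝ) + 1) ^ (J * κ + 1) * (1 + (r⁻¹) ^ κ)) := by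
        refine mul_le_mul_of_nonneg_left ?_ (by positivity)
        have h1 : (1:ℝ) ≤ ((N:ℝ) + 1) ^ (J * κ) := one_le_pow₀ (by linarith)
        have h2 : R = ((N:ℝ) + 1) ^ (J * κ) * (r⁻¹) ^ κ := by
          rw [hR, mul_pow, pow_mul, add_comm (1:ℝ)]
        have h3 : 0 ≤ (r⁻¹) ^ κ := by positivity
        rw [h2, pow_succ, mul_comm (_ ^ _) ((N:ℝ) + 1), mul_assoc]
        refine mul_le_mul_of_nonneg_left ?_ (by positivity)
        nlinarith
    _ ≤ (m:ℝ) ^ N * ((C * ζ ^ N) * (1 + (r⁻¹) ^ κ)) := by gcongr; exact hCn N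
    _ = _ := by ring

/-- Main counting claim. -/
def Claim (m : ℕ) (g l : ℝ) (j k : ℕ) : Prop := ∀ ζ : ℝ, 1 < ζ → ∃ C : ℝ, 0 < C ∧
  ∀ n1 n2 : ℕ, n1 ≤ n2 → ((AS m n2 j k g l (g ^ n1) (l ^ n2)).ncard : ℝ) ≤
    C * ζ ^ n2 * (l ^ n2 / ((m:ℝ) * l) ^ n1) * (m:ℝ) ^ (2 * n2)

/-- Diagonal counting claim. -/
def DClaim (m : ℕ) (g l : ℝ) (j k : ℕ) : Prop := ∀ ζ : ℝ, 1 < ζ → ∃ C : ℝ, 0 < C ∧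
  ∀ n : ℕ, ((AS m n j k g l (g ^ n) (l ^ n)).ncard : ℝ) ≤ C * ζ ^ n * (m:ℝ) ^ n

lemma DClaim_of_Claim {m : ℕ} (hm : 2 ≤ m) {g l : ℝ} (hl0 : 0 < l) {j k : ℕ} (h : Claim m g l j k) :
    DClaim m g l j k := by
  intro ζ hζ
  obtain ⟨C, hC, H⟩ := h ζ hζ
  refine ⟨C, hC, fun n => (H n n le_rfl).trans (le_of_eq ?_)⟩
  have hm0 : (0:ℝ) < m := by exact_mod_cast (by omega : 0 < m)
  rw [mul_pow, two_mul, pow_add]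
  field_simp

lemma base_DClaim (m : ℕ) (hm : 2 ≤ m) (g l : ℝ) (hg0 : 0 < g) (hg1 : g < 1) :
    ∃ J, ∀ j k, J ≤ j → DClaim m g l j k := by
  obtain ⟨J, H⟩ := base_count m hm g hg0 hg1
  refine ⟨J, fun j k hj ζ hζ => ?_⟩
  obtain ⟨C, hC, h⟩ := H ζ hζ
  refine ⟨C, hC, fun n => le_trans ?_ (h n)⟩
  have : AS m n j k g l (g ^ n) (l ^ n) ⊆ {p | ∀ i ≤ J, |Jr i g (df p)| ≤ g ^ n} :=
    fun p hp i hi => hp.1 i (hi.trans hj)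
  exact_mod_cast Set.ncard_le_ncard this (Set.toFinite _)

lemma base_Claim (m : ℕ) (hm : 2 ≤ m) (g l : ℝ) (hl0 : 0 < l) (hl1 : l < 1) (hml : 1 ≤ m * l) :
    ∃ J, ∀ j k, J ≤ k → Claim m g l j k := by
  obtain ⟨J, H⟩ := base_count m hm l hl0 hl1
  refine ⟨J, fun j k hk ζ hζ => ?_⟩
  obtain ⟨C, hC, h⟩ := H ζ hζ
  refine ⟨C, hC, fun n1 n2 hn => ?_⟩
  have h1 : ((AS m n2 j k g l (g ^ n1) (l ^ n2)).ncard : ℝ) ≤ C * ζ ^ n2 * (m:ℝ) ^ n2 := by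
    refine le_trans ?_ (h n2)
    have : AS m n2 j k g l (g ^ n1) (l ^ n2) ⊆ {p | ∀ i ≤ J, |Jr i l (df p)| ≤ l ^ n2} :=
      fun p hp i hi => hp.2 i (hi.trans hk)
    exact_mod_cast Set.ncard_le_ncard this (Set.toFinite _)
  refine h1.trans ?_
  have hm0 : (0:ℝ) < m := by exact_mod_cast (by omega : 0 < m)
  rw [mul_assoc (C * ζ ^ n2)]
  gcongr
  have h2 : ((m:ℝ) * l) ^ n1 ≤ ((m:ℝ) * l) ^ n2 := pow_le_pow_right₀ hml hn
  rw [div_mul_eq_mul_div, le_div_iff₀ (by positivity)]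
  calc (m:ℝ) ^ n2 * ((m:ℝ) * l) ^ n1 ≤ (m:ℝ) ^ n2 * ((m:ℝ) * l) ^ n2 := by gcongr
    _ = _ := by rw [mul_pow, two_mul, pow_add]; ring

lemma scale_lem (x : ℝ) (hx0 : 0 < x) (hx1 : x < 1) : ∃ κ : ℕ, ∀ n q : ℕ, q ≤ n → ∃ r r' : ℕ,
    r ≤ κ * n + 1 ∧ r' ≤ κ * n + 1 ∧ x ^ n ≤ (1 / 2) ^ r ∧ (1 / 2) ^ r' ≤ x ^ q ∧
      (1 / 2 : ℝ) ^ (r - r') ≤ 4 * (x ^ n / x ^ q) := by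
  obtain ⟨κ, hκ⟩ := exists_pow_lt_of_lt_one hx0 (by norm_num : (1 / 2 : ℝ) < 1)
  have key : ∀ n s : ℕ, x ^ n ≤ (1 / 2 : ℝ) ^ s → s ≤ κ * n := by
    intro n s h
    have : (1 / 2 : ℝ) ^ (κ * n) ≤ (1 / 2) ^ s := by
      rw [pow_mul]
      exact (pow_le_pow_left₀ (by positivity) hκ.le n).trans h
    exact (pow_le_pow_iff_right_of_lt_one₀ (by norm_num) (by norm_num)).1 this
  refine ⟨κ, fun n q hq => ?_⟩
  obtain ⟨r, hr1, hr2⟩ := exists_nat_pow_near_of_lt_one (pow_pos hx0 n)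
    (pow_le_one₀ hx0.le hx1.le) (by norm_num : (0:ℝ) < 1 / 2) (by norm_num)
  obtain ⟨s, hs1, hs2⟩ := exists_nat_pow_near_of_lt_one (pow_pos hx0 q)
    (pow_le_one₀ hx0.le hx1.le) (by norm_num : (0:ℝ) < 1 / 2) (by norm_num)
  have k1 := key _ _ hr2
  have k2 := (key _ _ hs2).trans (Nat.mul_le_mul_left κ hq)
  refine ⟨r, s + 1, by omega, by omega, hr2, hs1.le, ?_⟩
  have hxq : 0 < x ^ q := by positivity
  rw [← mul_div_assoc, le_div_iff₀ hxq]
  rcases le_total (s + 1) r with h | h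
  · calc (1 / 2 : ℝ) ^ (r - (s + 1)) * x ^ q ≤ (1 / 2 : ℝ) ^ (r - (s + 1)) * (1 / 2) ^ s := by gcongr
      _ = 4 * ((1 / 2) ^ (r - (s + 1)) * (1 / 2) ^ s * (1 / 2) ^ 2) := by ring
      _ = 4 * (1 / 2) ^ (r + 1) := by rw [← pow_add, ← pow_add]; congr 2; omega
      _ ≤ _ := by gcongr
  · rw [Nat.sub_eq_zero_of_le h, pow_zero, one_mul]
    calc x ^ q ≤ (1 / 2 : ℝ) ^ s := hs2
      _ = 4 * (1 / 2) ^ (s + 1 + 1) := by ring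
      _ ≤ 4 * (1 / 2) ^ (r + 1) := by
          gcongr 4 * ?_
          exact pow_le_pow_of_le_one (by norm_num) (by norm_num) (by omega)
      _ ≤ _ := by gcongr

/-- Hypothesis coming from the almost-everywhere transversality estimate. -/
def HGood (m : ℕ) (g l : ℝ) (j k : ℕ) : Prop :=
  ∃ C : ℝ, 0 ≤ C ∧ ∀ N r1 r1' r2 r2' : ℕ,
      ((GS m N j k r1 r1' r2 r2' g l).ncard : ℝ) ≤
        C * ((m : ℝ) ^ (2 * N) * (4 * (N + 1) ^ 2 * ((1 / 2) ^ (r1 - r1') * (1 / 2) ^ (r2 - r2')))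
          * (((N:ℝ) + 1) ^ 2 * (((r1:ℝ) + 1) ^ 2 * (((r1':ℝ) + 1) ^ 2 * (((r2:ℝ) + 1) ^ 2 *
            ((r2':ℝ) + 1) ^ 2)))))

/-- The target size. -/
def TT (m : ℕ) (l : ℝ) (n1 n2 : ℕ) : ℝ := (l ^ n2 / ((m:ℝ) * l) ^ n1) * (m:ℝ) ^ (2 * n2)

lemma good_bound (m : ℕ) (hm : 2 ≤ m) (g l : ℝ) (hg0 : 0 < g) (hg1 : g < 1) (hl0 : 0 < l) (hl1 : l < 1)
    (hml : 1 ≤ m * l) (hmgl : m * l * g ≤ 1) (j k : ℕ) (H : HGood m g l j k) :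
    ∃ C : ℝ, 0 ≤ C ∧ ∀ n1 n2 q : ℕ, n1 ≤ n2 → q ≤ n2 →
      ({p : PW m n2 | |Jr j g (df p)| ≤ g ^ n1 ∧ (q ≤ n1 → g ^ q ≤ |Jr (j + 1) g (df p)|) ∧
        |Jr k l (df p)| ≤ l ^ n2 ∧ l ^ q ≤ |Jr (k + 1) l (df p)|}.ncard : ℝ) ≤
      C * ((n2:ℝ) + 1) ^ 12 * (m / (g * l)) ^ q * TT m l n1 n2 := by
  have hm0 : (0:ℝ) < m := by exact_mod_cast (by omega : 0 < m)
  have hm1 : (1:ℝ) ≤ m := by exact_mod_cast (by omega : 1 ≤ m)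
  obtain ⟨C, hC, H⟩ := H
  obtain ⟨κ1, h1⟩ := scale_lem g hg0 hg1
  obtain ⟨κ2, h2⟩ := scale_lem l hl0 hl1
  refine ⟨C * 4 * ((κ1 + 2) ^ 4 * (κ2 + 2) ^ 4) * 16, by positivity, fun n1 n2 q hn hq => ?_⟩
  obtain ⟨r2, r2', a1, a2, a3, a4, a5⟩ := h2 n2 q hq
  obtain ⟨r1, r1', b1, b2, b3, b4⟩ : ∃ r1 r1' : ℕ, r1 ≤ κ1 * n2 + 1 ∧ r1' ≤ κ1 * n2 + 1 ∧
      (∀ p : PW m n2, |Jr j g (df p)| ≤ g ^ n1 → (q ≤ n1 → g ^ q ≤ |Jr (j + 1) g (df p)|) →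
        GC j r1 r1' g (df p)) ∧
      (1 / 2 : ℝ) ^ (r1 - r1') ≤ 4 * ((m / g) ^ q / (m * l) ^ n1) := by
    by_cases hqn : q ≤ n1
    · obtain ⟨r, r', c1, c2, c3, c4, c5⟩ := h1 n1 q hqn
      have := Nat.mul_le_mul_left κ1 hn
      refine ⟨r, r', by omega, by omega, fun p u v => Or.inr ⟨u.trans c3, c4.trans (v hqn)⟩,
        c5.trans ?_⟩
      gcongr 4 * ?_
      rw [div_le_div_iff₀ (by positivity) (by positivity), div_pow]
      calc g ^ n1 * (m * l) ^ n1 = (m * l * g) ^ n1 := by rw [← mul_pow]; ring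
        _ ≤ 1 := pow_le_one₀ (by positivity) hmgl
        _ ≤ (m:ℝ) ^ q := one_le_pow₀ hm1
        _ = _ := by field_simp
    · refine ⟨0, 1, by omega, by omega, fun p u v => Or.inl one_pos, ?_⟩
      have : (1:ℝ) ≤ (m / g) ^ q / (m * l) ^ n1 := by
        rw [one_le_div (by positivity)]
        calc ((m:ℝ) * l) ^ n1 ≤ (m:ℝ) ^ n1 := by
              gcongr; nlinarith
          _ ≤ (m:ℝ) ^ q := pow_le_pow_right₀ hm1 (by omega)
          _ ≤ _ := by
              gcongr
              rw [le_div_iff₀ hg0]; nlinarith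
      simp; linarith
  have hsub : {p : PW m n2 | |Jr j g (df p)| ≤ g ^ n1 ∧ (q ≤ n1 → g ^ q ≤ |Jr (j + 1) g (df p)|) ∧
        |Jr k l (df p)| ≤ l ^ n2 ∧ l ^ q ≤ |Jr (k + 1) l (df p)|} ⊆ GS m n2 j k r1 r1' r2 r2' g l := by
    intro p hp
    exact ⟨b3 p hp.1 hp.2.1, Or.inr ⟨hp.2.2.1.trans a3, a4.trans hp.2.2.2⟩⟩
  have hc := Set.ncard_le_ncard hsub (Set.toFinite _)
  have hc' : ({p : PW m n2 | |Jr j g (df p)| ≤ g ^ n1 ∧ (q ≤ n1 → g ^ q ≤ |Jr (j + 1) g (df p)|) ∧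
        |Jr k l (df p)| ≤ l ^ n2 ∧ l ^ q ≤ |Jr (k + 1) l (df p)|}.ncard : ℝ) ≤
      ((GS m n2 j k r1 r1' r2 r2' g l).ncard : ℝ) := by exact_mod_cast hc
  refine hc'.trans ((H _ _ _ _ _).trans ?_)
  have hr : ∀ r κ : ℕ, r ≤ κ * n2 + 1 → (r:ℝ) + 1 ≤ ((κ:ℝ) + 2) * (n2 + 1) := by
    intro r κ h
    have : (r:ℝ) ≤ κ * n2 + 1 := by exact_mod_cast h
    have h1 : (0:ℝ) ≤ κ := by positivity
    have h2 : (0:ℝ) ≤ n2 := by positivity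
    nlinarith
  have e1 := hr _ _ b1
  have e2 := hr _ _ b2
  have e3 := hr _ _ a1
  have e4 := hr _ _ a2
  calc _ ≤ C * ((m : ℝ) ^ (2 * n2) * (4 * (n2 + 1) ^ 2 *
          ((4 * ((m / g) ^ q / (m * l) ^ n1)) * (4 * (l ^ n2 / l ^ q))))
          * (((n2:ℝ) + 1) ^ 2 * ((((κ1:ℝ) + 2) * (n2 + 1)) ^ 2 * ((((κ1:ℝ) + 2) * (n2 + 1)) ^ 2 *
            ((((κ2:ℝ) + 2) * (n2 + 1)) ^ 2 * (((κ2:ℝ) + 2) * (n2 + 1)) ^ 2))))) := by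
        gcongr
    _ = _ := by
        rw [TT, div_pow, div_pow, mul_pow g l q]
        field_simp
        ring

lemma inner_ind (a T : ℕ → ℕ → ℝ) (N q : ℕ) (X Y : ℝ) (hX : 0 ≤ X) (hY : 0 ≤ Y)
    (hT : ∀ n1 n2, 0 ≤ T n1 n2)
    (hbase : ∀ n1 n2, n1 ≤ n2 → n2 < q → a n1 n2 ≤ X * T n1 n2)
    (hrec : ∀ n1 n2, n1 ≤ n2 → q ≤ n2 → n2 ≤ N →
      a n1 n2 ≤ X * T n1 n2 + Y * T (min n1 q) q * a (n1 - q) (n2 - q))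
    (hmul : ∀ n1 n2, q ≤ n2 → T (min n1 q) q * T (n1 - q) (n2 - q) = T n1 n2) :
    ∀ t n1 n2, n1 ≤ n2 → n2 ≤ N → n2 < (t + 1) * q → a n1 n2 ≤ X * (1 + Y) ^ t * T n1 n2 := by
  intro t
  induction t with
  | zero => intro n1 n2 h1 h2 h3; simpa using hbase n1 n2 h1 (by simpa using h3)
  | succ t ih =>
    intro n1 n2 h1 h2 h3
    have hp : 1 ≤ (1 + Y) ^ t := one_le_pow₀ (by linarith)
    have hXT : 0 ≤ X * T n1 n2 := mul_nonneg hX (hT _ _)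
    rcases lt_or_ge n2 q with hq | hq
    · refine (hbase n1 n2 h1 hq).trans ?_
      have : 1 ≤ (1 + Y) ^ (t + 1) := one_le_pow₀ (by linarith)
      nlinarith
    · have h4 := ih (n1 - q) (n2 - q) (by omega) (by omega) (by
        rw [Nat.sub_lt_iff_lt_add hq]; linarith)
      have h5 := hrec n1 n2 h1 hq h2
      calc a n1 n2 ≤ _ := h5
        _ ≤ X * T n1 n2 + Y * T (min n1 q) q * (X * (1 + Y) ^ t * T (n1 - q) (n2 - q)) := by
            have := hT (min n1 q) q
            gcongr
        _ = X * T n1 n2 + Y * (X * (1 + Y) ^ t) * (T (min n1 q) q * T (n1 - q) (n2 - q)) := by ring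
        _ = X * T n1 n2 * (1 + Y * (1 + Y) ^ t) := by rw [hmul n1 n2 hq]; ring
        _ ≤ X * T n1 n2 * ((1 + Y) ^ t + Y * (1 + Y) ^ t) := by gcongr
        _ = _ := by ring

lemma TT_mul (m : ℕ) (l : ℝ) (hm : 2 ≤ m) (hl0 : 0 < l) (q n1 n2 : ℕ) (hq : q ≤ n2) :
    TT m l (min n1 q) q * TT m l (n1 - q) (n2 - q) = TT m l n1 n2 := by
  have hm0 : (0:ℝ) < m := by exact_mod_cast (by omega : 0 < m)
  have e1 : n2 = q + (n2 - q) := by omega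
  have e2 : n1 = min n1 q + (n1 - q) := by omega
  simp only [TT]
  conv_rhs => rw [e1, e2]
  generalize n2 - q = a
  generalize n1 - q = b
  generalize min n1 q = c
  rw [pow_add, pow_add, mul_add, pow_add]
  field_simp

lemma TT_pos (m : ℕ) (l : ℝ) (hm : 2 ≤ m) (hl0 : 0 < l) (n1 n2 : ℕ) : 0 < TT m l n1 n2 := by
  have hm0 : (0:ℝ) < m := by exact_mod_cast (by omega : 0 < m)
  simp only [TT]; positivity

lemma TT_ge (m : ℕ) (l : ℝ) (hm : 2 ≤ m) (hl0 : 0 < l) (hml : 1 ≤ m * l) (n1 n2 : ℕ) (h : n1 ≤ n2) :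
    (m:ℝ) ^ n2 ≤ TT m l n1 n2 := by
  have hm0 : (0:ℝ) < m := by exact_mod_cast (by omega : 0 < m)
  have h2 : ((m:ℝ) * l) ^ n1 ≤ ((m:ℝ) * l) ^ n2 := pow_le_pow_right₀ hml h
  rw [TT, div_mul_eq_mul_div, le_div_iff₀ (by positivity)]
  calc (m:ℝ) ^ n2 * ((m:ℝ) * l) ^ n1 ≤ (m:ℝ) ^ n2 * ((m:ℝ) * l) ^ n2 := by gcongr
    _ = _ := by rw [mul_pow, two_mul, pow_add]; ring

lemma TT_diag (m : ℕ) (l : ℝ) (hm : 2 ≤ m) (hl0 : 0 < l) (n : ℕ) : TT m l n n = (m:ℝ) ^ n := by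
  have hm0 : (0:ℝ) < m := by exact_mod_cast (by omega : 0 < m)
  rw [TT, mul_pow, two_mul, pow_add]; field_simp

lemma AS_trivial (m : ℕ) (l : ℝ) (hm : 2 ≤ m) (hl0 : 0 < l) (hml : 1 ≤ m * l) (n1 n2 : ℕ) (h : n1 ≤ n2)
    (S : Set (PW m n2)) (q : ℕ) (hq : n2 ≤ q) : (S.ncard : ℝ) ≤ (m:ℝ) ^ q * TT m l n1 n2 := by
  have hm1 : (1:ℝ) ≤ m := by exact_mod_cast (by omega : 1 ≤ m)
  have h1 : (S.ncard : ℝ) ≤ (m:ℝ) ^ (2 * n2) := by exact_mod_cast card_PW m n2 S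
  calc _ ≤ _ := h1
    _ = (m:ℝ) ^ n2 * (m:ℝ) ^ n2 := by rw [two_mul, pow_add]
    _ ≤ _ := by
        gcongr
        exact TT_ge m l hm hl0 hml n1 n2 h

lemma rec_step (m : ℕ) (hm : 2 ≤ m) (g l : ℝ) (hg0 : 0 < g) (hg1 : g < 1) (hl0 : 0 < l) (hl1 : l < 1)
    (hml : 1 ≤ m * l) (hmgl : m * l * g ≤ 1) (j k : ℕ) (H : HGood m g l j k)
    (H1 : DClaim m g l (j + 1) k) (H2 : Claim m g l j (k + 1)) :
    ∃ C0 : ℝ, 0 ≤ C0 ∧ ∀ ζ : ℝ, 1 < ζ → ∃ C : ℝ, 0 < C ∧ ∀ n1 n2 q : ℕ, n1 ≤ n2 → q ≤ n2 →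
      ((AS m n2 j k g l (g ^ n1) (l ^ n2)).ncard : ℝ) ≤
        C0 * ((n2:ℝ) + 1) ^ 12 * (m / (g * l)) ^ q * TT m l n1 n2 +
        (C * ζ ^ q) * TT m l (min n1 q) q *
          (AS m (n2 - q) j k g l (g ^ (n1 - q)) (l ^ (n2 - q))).ncard := by
  obtain ⟨C0, hC0, HG⟩ := good_bound m hm g l hg0 hg1 hl0 hl1 hml hmgl j k H
  refine ⟨C0, hC0, fun ζ hζ => ?_⟩
  have hm0 : (0:ℝ) < m := by exact_mod_cast (by omega : 0 < m)
  set J := max (j + 1) (k + 1) with hJ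
  obtain ⟨S, hS⟩ := rec_bad m g l hg0 hg1 hl0 hl1 J
  obtain ⟨ξ, hξ1, hξ2⟩ : ∃ ξ : ℝ, 1 < ξ ∧ ξ * ξ = ζ :=
    ⟨Real.sqrt ζ, Real.lt_sqrt_of_sq_lt (by linarith), Real.mul_self_sqrt (by linarith)⟩
  obtain ⟨C1, hC1, D1⟩ := H1 ξ hξ1
  obtain ⟨C2, hC2, D2⟩ := H2 ξ hξ1
  obtain ⟨C3, hC3, D3⟩ := poly_exp (J * (4 * J + 4)) ξ hξ1
  refine ⟨(2 * S + 2) ^ (4 * J + 4) * C3 * (C1 + C2), by positivity, fun n1 n2 q hn hq => ?_⟩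
  obtain ⟨M, rfl⟩ := Nat.exists_eq_add_of_le hq
  rw [Nat.add_sub_cancel_left]
  set A := AS m (q + M) j k g l (g ^ n1) (l ^ (q + M)) with hA
  set G := {p : PW m (q + M) | |Jr j g (df p)| ≤ g ^ n1 ∧ (q ≤ n1 → g ^ q ≤ |Jr (j + 1) g (df p)|) ∧
        |Jr k l (df p)| ≤ l ^ (q + M) ∧ l ^ q ≤ |Jr (k + 1) l (df p)|} with hG
  set B1 := {p : PW m (q + M) | p ∈ A ∧ p ∈ AS m (q + M) (j + 1) k g l (g ^ (min n1 q)) (l ^ q)} with hB1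
  set B2 := {p : PW m (q + M) | p ∈ A ∧ p ∈ AS m (q + M) j (k + 1) g l (g ^ (min n1 q)) (l ^ q)} with hB2
  have hlq : l ^ (q + M) ≤ l ^ q := pow_le_pow_of_le_one hl0.le hl1.le hq
  have hgq : g ^ n1 ≤ g ^ (min n1 q) := pow_le_pow_of_le_one hg0.le hg1.le (min_le_left _ _)
  have s1 := hS j k (j + 1) k q M n1 (by omega) (by omega) (by omega) (by omega)
  have s2 := hS j k j (k + 1) q M n1 (by omega) (by omega) (by omega) (by omega)
  set a := (AS m M j k g l (g ^ (n1 - q)) (l ^ M)).ncard with ha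
  have hP : (2 * ((S:ℝ) * (1 + q) ^ J) + 2) ^ (4 * J + 4) ≤ (2 * S + 2) ^ (4 * J + 4) * (C3 * ξ ^ q) := by
    have h1 : 2 * ((S:ℝ) * (1 + q) ^ J) + 2 ≤ (2 * S + 2) * ((q:ℝ) + 1) ^ J := by
      have : (1:ℝ) ≤ ((q:ℝ) + 1) ^ J := one_le_pow₀ (by
        have : (0:ℝ) ≤ q := by positivity
        linarith)
      rw [add_comm (1:ℝ)]; nlinarith
    calc _ ≤ ((2 * S + 2) * ((q:ℝ) + 1) ^ J) ^ (4 * J + 4) := by gcongr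
      _ = (2 * S + 2) ^ (4 * J + 4) * ((q:ℝ) + 1) ^ (J * (4 * J + 4)) := by
          rw [mul_pow, ← pow_mul]
      _ ≤ _ := by gcongr; exact D3 q
  have hsub : A ⊆ G ∪ ((if q ≤ n1 then B1 else ∅) ∪ B2) := by
    intro p hp
    by_cases h2 : l ^ q ≤ |Jr (k + 1) l (df p)|
    · by_cases h1 : q ≤ n1 → g ^ q ≤ |Jr (j + 1) g (df p)|
      · exact Or.inl ⟨hp.1 j le_rfl, h1, hp.2 k le_rfl, h2⟩
      · push Not at h1
        refine Or.inr (Or.inl ?_)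
        rw [if_pos h1.1]
        refine ⟨hp, fun i hi => ?_, fun i hi => (hp.2 i hi).trans hlq⟩
        rcases Nat.lt_or_eq_of_le hi with hi | rfl
        · exact (hp.1 i (by omega)).trans hgq
        · rw [min_eq_right h1.1]; exact h1.2.le
    · push Not at h2
      refine Or.inr (Or.inr ⟨hp, fun i hi => (hp.1 i hi).trans hgq, fun i hi => ?_⟩)
      rcases Nat.lt_or_eq_of_le hi with hi | rfl
      · exact (hp.2 i (by omega)).trans hlq
      · exact h2.le
  have hcard : (A.ncard : ℝ) ≤ G.ncard + (((if q ≤ n1 then B1 else ∅).ncard : ℝ) + B2.ncard) := by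
    have h1 := Set.ncard_le_ncard hsub (Set.toFinite _)
    have h2 := Set.ncard_union_le G ((if q ≤ n1 then B1 else ∅) ∪ B2)
    have h3 := Set.ncard_union_le (if q ≤ n1 then B1 else ∅) B2
    exact_mod_cast h1.trans (h2.trans (Nat.add_le_add_left h3 _))
  have hT := TT_pos m l hm hl0 (min n1 q) q
  set PP : ℝ := (2 * S + 2) ^ (4 * J + 4) * (C3 * ξ ^ q) with hPP
  have b1 : (((if q ≤ n1 then B1 else ∅).ncard : ℝ)) ≤
      PP * (a * (C1 * ξ ^ q * TT m l (min n1 q) q)) := by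
    by_cases hqn : q ≤ n1
    · rw [if_pos hqn]
      have s1' : (B1.ncard : ℝ) ≤ (2 * ((S:ℝ) * (1 + q) ^ J) + 2) ^ (4 * J + 4) * (a *
        (AS m q (j + 1) k g l (g ^ (min n1 q)) (l ^ q)).ncard) := by exact_mod_cast s1
      refine s1'.trans ?_
      have := D1 q
      rw [min_eq_right hqn, TT_diag m l hm hl0]
      gcongr
    · rw [if_neg hqn]; simp; positivity
  have b2 : (B2.ncard : ℝ) ≤ PP * (a * (C2 * ξ ^ q * TT m l (min n1 q) q)) := by
    have s2' : (B2.ncard : ℝ) ≤ (2 * ((S:ℝ) * (1 + q) ^ J) + 2) ^ (4 * J + 4) * (a *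
        (AS m q j (k + 1) g l (g ^ (min n1 q)) (l ^ q)).ncard) := by exact_mod_cast s2
    refine s2'.trans ?_
    have := D2 (min n1 q) q (min_le_right _ _)
    rw [mul_assoc (C2 * ξ ^ q)] at this
    change _ ≤ C2 * ξ ^ q * TT m l (min n1 q) q at this
    gcongr
  have b0 := HG n1 (q + M) q hn hq
  refine hcard.trans (add_le_add b0 ((add_le_add b1 b2).trans (le_of_eq ?_)))
  rw [← hξ2, mul_pow, hPP]
  ring

lemma Claim_step (m : ℕ) (hm : 2 ≤ m) (g l : ℝ) (hg0 : 0 < g) (hg1 : g < 1) (hl0 : 0 < l) (hl1 : l < 1)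
    (hml : 1 ≤ m * l) (hmgl : m * l * g ≤ 1) (j k : ℕ) (H : HGood m g l j k)
    (H1 : DClaim m g l (j + 1) k) (H2 : Claim m g l j (k + 1)) : Claim m g l j k := by
  obtain ⟨C0, hC0, HR⟩ := rec_step m hm g l hg0 hg1 hl0 hl1 hml hmgl j k H H1 H2
  have hm0 : (0:ℝ) < m := by exact_mod_cast (by omega : 0 < m)
  have hm1 : (1:ℝ) ≤ m := by exact_mod_cast (by omega : 1 ≤ m)
  intro ζ hζ
  obtain ⟨ξ, hξ1, hξ2⟩ : ∃ ξ : ℝ, 1 < ξ ∧ ξ ^ 4 = ζ :=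
    ⟨ζ ^ (((4:ℕ):ℝ)⁻¹), Real.one_lt_rpow hζ (by norm_num),
      Real.rpow_inv_natCast_pow (by linarith) (by norm_num)⟩
  obtain ⟨C, hC, HR⟩ := HR ξ hξ1
  obtain ⟨C3, hC3, D3⟩ := poly_exp 12 ξ hξ1
  set Λ : ℝ := m / (g * l) with hΛ
  have hΛm : m ≤ Λ := by
    rw [hΛ, le_div_iff₀ (by positivity)]
    nlinarith [mul_pos hg0 hl0, mul_lt_one_of_nonneg_of_lt_one_left hg0.le hg1 hl1.le]
  obtain ⟨L, hL⟩ := pow_unbounded_of_one_lt Λ hξ1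
  have hL0 : 0 < L := by
    rcases Nat.eq_zero_or_pos L with h | h
    · subst h; simp at hL; linarith
    · exact h
  refine ⟨(m:ℝ) ^ L + (C0 + 1) * C3 * (1 + C) ^ (2 * L), by positivity, fun n1 n2 hn => ?_⟩
  rw [mul_assoc (_ * _)]
  change _ ≤ _ * TT m l n1 n2
  have hT := TT_pos m l hm hl0 n1 n2
  have hζn : 1 ≤ ζ ^ n2 := one_le_pow₀ hζ.le
  rcases lt_or_ge n2 L with hnL | hnL
  · refine (AS_trivial m l hm hl0 hml n1 n2 hn _ L hnL.le).trans ?_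
    gcongr
    have : 0 ≤ (C0 + 1) * C3 * (1 + C) ^ (2 * L) := by positivity
    have h2 : 0 < (m:ℝ) ^ L := by positivity
    nlinarith
  · set q := n2 / L with hq
    have hqL : q * L ≤ n2 := Nat.div_mul_le_self n2 L
    have hq1 : 1 ≤ q := (Nat.one_le_div_iff hL0).2 hnL
    have hqn : n2 < (2 * L + 1) * q := by
      have := Nat.lt_div_mul_add (a := n2) hL0
      rw [← hq] at this
      nlinarith
    have hΛq : Λ ^ q ≤ ξ ^ n2 := by
      calc Λ ^ q ≤ (ξ ^ L) ^ q := by gcongr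
        _ = ξ ^ (q * L) := by rw [← pow_mul, mul_comm]
        _ ≤ _ := pow_le_pow_right₀ hξ1.le hqL
    have hmq : (m:ℝ) ^ q ≤ Λ ^ q := by gcongr
    set X : ℝ := (C0 + 1) * ((n2:ℝ) + 1) ^ 12 * Λ ^ q with hX
    have hn2 : (1:ℝ) ≤ ((n2:ℝ) + 1) ^ 12 := one_le_pow₀ (by
        have : (0:ℝ) ≤ n2 := by positivity
        linarith)
    have hΛ0 : 0 < Λ := lt_of_lt_of_le hm0 hΛm
    have hΛq0 : 0 < Λ ^ q := by positivity
    have hXm : (m:ℝ) ^ q ≤ X := by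
      refine hmq.trans ?_
      rw [hX]
      have : 1 ≤ (C0 + 1) * ((n2:ℝ) + 1) ^ 12 := by nlinarith
      nlinarith
    have main := inner_ind (fun n1 n2 => ((AS m n2 j k g l (g ^ n1) (l ^ n2)).ncard : ℝ)) (TT m l)
      n2 q X (C * ξ ^ q) (by positivity) (by positivity) (fun a b => (TT_pos m l hm hl0 a b).le)
      (fun a b hab hb => (AS_trivial m l hm hl0 hml a b hab _ q hb.le).trans (by
        have := TT_pos m l hm hl0 a b
        gcongr))
      (fun a b hab hqb hbn => (HR a b q hab hqb).trans (by
        have := TT_pos m l hm hl0 a b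
        gcongr
        rw [hX]
        gcongr
        linarith))
      (fun a b hqb => TT_mul m l hm hl0 q a b hqb) (2 * L) n1 n2 hn le_rfl hqn
    refine main.trans (mul_le_mul_of_nonneg_right ?_ hT.le)
    have hY : 1 + C * ξ ^ q ≤ (1 + C) * ξ ^ q := by
      have : 1 ≤ ξ ^ q := one_le_pow₀ hξ1.le
      nlinarith
    have hY2 : (1 + C * ξ ^ q) ^ (2 * L) ≤ (1 + C) ^ (2 * L) * ξ ^ (2 * n2) := by
      calc _ ≤ ((1 + C) * ξ ^ q) ^ (2 * L) := by gcongr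
        _ = (1 + C) ^ (2 * L) * ξ ^ (2 * (q * L)) := by
            rw [mul_pow, ← pow_mul]; congr 2; ring
        _ ≤ _ := by
            gcongr
            exact hξ1.le
    have hX2 : X ≤ (C0 + 1) * (C3 * ξ ^ n2) * ξ ^ n2 := by
      rw [hX]; gcongr; exact D3 n2
    calc X * (1 + C * ξ ^ q) ^ (2 * L) ≤ ((C0 + 1) * (C3 * ξ ^ n2) * ξ ^ n2) *
          ((1 + C) ^ (2 * L) * ξ ^ (2 * n2)) := by gcongr
      _ = (C0 + 1) * C3 * (1 + C) ^ (2 * L) * ζ ^ n2 := by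
          rw [← hξ2, ← pow_mul]
          have : ξ ^ (4 * n2) = ξ ^ n2 * ξ ^ n2 * ξ ^ (2 * n2) := by
            rw [← pow_add, ← pow_add]; congr 1; ring
          rw [this]; ring
      _ ≤ _ := by
          have : 0 < (m:ℝ) ^ L := by positivity
          gcongr
          linarith

lemma Claim_main (m : ℕ) (hm : 2 ≤ m) (g l : ℝ) (hg0 : 0 < g) (hg1 : g < 1) (hl0 : 0 < l) (hl1 : l < 1)
    (hml : 1 ≤ m * l) (hmgl : m * l * g ≤ 1) (H : ∀ j k, HGood m g l j k) : Claim m g l 0 0 := by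
  obtain ⟨J1, hJ1⟩ := base_DClaim m hm g l hg0 hg1
  obtain ⟨J2, hJ2⟩ := base_Claim m hm g l hl0 hl1 hml
  have step : ∀ j, (∀ k, DClaim m g l (j + 1) k) → ∀ k, Claim m g l j k := by
    intro j hj
    have : ∀ d k, J2 ≤ k + d → Claim m g l j k := by
      intro d
      induction d with
      | zero => intro k hk; exact hJ2 j k (by simpa using hk)
      | succ d ih =>
        intro k hk
        exact Claim_step m hm g l hg0 hg1 hl0 hl1 hml hmgl j k (H j k) (hj k) (ih (k + 1) (by omega))
    intro k; exact this J2 k (by omega)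
  have hD : ∀ d j, J1 ≤ j + d → ∀ k, DClaim m g l j k := by
    intro d
    induction d with
    | zero => intro j hj k; exact hJ1 j k (by simpa using hj)
    | succ d ih =>
      intro j hj k
      exact DClaim_of_Claim hm hl0 (step j (ih (j + 1) (by omega)) k)
  exact step 0 (hD J1 1 (by omega)) 0

lemma frostman_like {Ω : Type*} [MeasurableSpace Ω] (μ : Measure Ω) [IsProbabilityMeasure μ]
    (Φ : Ω → ℝ × ℝ) (hΦ : Measurable Φ) (l : ℝ) (hl0 : 0 < l) (hl1 : l < 1) (t : ℝ≥0) (ht : 0 < t)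
    (C ρ : ℝ) (hC : 0 ≤ C) (hρ0 : 0 < ρ) (hρ1 : ρ < 1)
    (h : ∀ n : ℕ, (μ.prod μ) {p : Ω × Ω | dist (Φ p.1) (Φ p.2) ≤ l ^ n} ≤
      ENNReal.ofReal (C * ρ ^ n * (l ^ n) ^ (t:ℝ))) : (t : ℝ≥0∞) ≤ dimH (range Φ) := by
  have ht' : (0:ℝ) < t := by exact_mod_cast ht
  set S : ℕ → Set (Ω × Ω) := fun n => {p | dist (Φ p.1) (Φ p.2) ≤ l ^ n} with hS
  have hSm : ∀ n, MeasurableSet (S n) := fun n =>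
    measurableSet_le (Measurable.dist (hΦ.comp measurable_fst) (hΦ.comp measurable_snd))
      measurable_const
  set f : ℕ → Ω → ℝ≥0∞ := fun n ω => μ (Prod.mk ω ⁻¹' S n) with hf
  have hfm : ∀ n, Measurable (f n) := fun n => measurable_measure_prodMk_left (hSm n)
  set c : ℕ → ℝ := fun n => ((l ^ n) ^ (t:ℝ))⁻¹ with hc
  have hc0 : ∀ n, 0 < c n := fun n => by simp only [hc]; positivity
  have hIntg : ∫⁻ ω, ∑' n, f n ω * ENNReal.ofReal (c n) ∂μ ≠ ∞ := by
    rw [lintegral_tsum fun n => ((hfm n).mul_const _).aemeasurable]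
    have hsum : Summable fun n : ℕ => C * ρ ^ n :=
      (summable_geometric_of_lt_one hρ0.le hρ1).mul_left C
    refine ne_top_of_le_ne_top hsum.tsum_ofReal_ne_top (ENNReal.tsum_le_tsum fun n => ?_)
    rw [lintegral_mul_const' _ _ ENNReal.ofReal_ne_top]
    simp only [hf]
    rw [← Measure.prod_apply (hSm n)]
    refine (mul_le_mul_left (h n) _).trans ?_
    rw [← ENNReal.ofReal_mul (by positivity)]
    apply ENNReal.ofReal_le_ofReal
    apply le_of_eq
    have : (l ^ n) ^ (t:ℝ) ≠ 0 := by positivity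
    simp only [hc]; field_simp
  have hae := ae_lt_top' (Measurable.aemeasurable
    (Measurable.tsum fun n => (hfm n).mul_const (ENNReal.ofReal (c n)))) hIntg
  set F : ℕ → Set Ω := fun A => {ω | ∀ n, f n ω * ENNReal.ofReal (c n) ≤ A} with hF
  have hFm : ∀ A, MeasurableSet (F A) := by
    intro A
    have : F A = ⋂ n, {ω | f n ω * ENNReal.ofReal (c n) ≤ A} := by ext; simp [hF]
    rw [this]
    exact MeasurableSet.iInter fun n => measurableSet_le ((hfm n).mul_const _) measurable_const
  obtain ⟨A, hA⟩ : ∃ A : ℕ, μ (F A) ≠ 0 := by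
    by_contra! hcon
    have h0 : μ (⋃ A, F A) = 0 := measure_iUnion_null hcon
    have h1 : ∀ᵐ ω ∂μ, ω ∈ ⋃ A, F A := by
      filter_upwards [hae] with ω hω
      obtain ⟨A, hA⟩ := ENNReal.exists_nat_gt hω.ne
      exact mem_iUnion.2 ⟨A, fun n => (ENNReal.le_tsum n).trans hA.le⟩
    have h2 : ∀ᵐ ω ∂μ, ω ∉ ⋃ A, F A := measure_eq_zero_iff_ae_notMem.1 h0
    obtain ⟨ω, a, b⟩ := (h1.and h2).exists
    exact b a
  have hfA : ∀ ω ∈ F A, ∀ n, f n ω ≤ ENNReal.ofReal ((A:ℝ) * (l ^ n) ^ (t:ℝ)) := by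
    intro ω hω n
    have h1 := hω n
    have h2 : f n ω = (f n ω * ENNReal.ofReal (c n)) * ENNReal.ofReal ((l ^ n) ^ (t:ℝ)) := by
      rw [mul_assoc, ← ENNReal.ofReal_mul (hc0 n).le]
      simp only [hc]
      rw [inv_mul_cancel₀ (by positivity), ENNReal.ofReal_one, mul_one]
    rw [h2, ENNReal.ofReal_mul (by positivity), ENNReal.ofReal_natCast]
    gcongr
  set ν := (μ.restrict (F A)).map Φ with hν
  set D : ℝ := (A + 1) * (l ^ (t:ℝ))⁻¹ with hD
  have hD0 : 0 < D := by positivity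
  have hνb : ∀ U : Set (ℝ × ℝ), Metric.ediam U ≤ 1 →
      ν U ≤ ENNReal.ofReal D * Metric.ediam U ^ (t:ℝ) := by
    intro U hU
    have hcl : Metric.ediam (closure U) = Metric.ediam U := Metric.ediam_closure U
    have hUtop : Metric.ediam U ≠ ∞ := ne_top_of_le_ne_top ENNReal.one_ne_top hU
    refine (measure_mono (subset_closure (s := U))).trans ?_
    rw [hν, Measure.map_apply hΦ isClosed_closure.measurableSet,
      Measure.restrict_apply (hΦ isClosed_closure.measurableSet)]
    rcases (Φ ⁻¹' closure U ∩ F A).eq_empty_or_nonempty with he | ⟨ω, hω1, hω2⟩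
    · rw [he]; simp
    · have key : ∀ n : ℕ, Metric.ediam U ≤ ENNReal.ofReal (l ^ n) →
          μ (Φ ⁻¹' closure U ∩ F A) ≤ ENNReal.ofReal ((A:ℝ) * (l ^ n) ^ (t:ℝ)) := by
        intro n hn
        refine le_trans (measure_mono ?_) (hfA ω hω2 n)
        intro τ hτ
        change dist (Φ ω) (Φ τ) ≤ l ^ n
        have h1 : edist (Φ ω) (Φ τ) ≤ Metric.ediam (closure U) :=
          Metric.edist_le_ediam_of_mem hω1 hτ.1
        rw [hcl] at h1
        have h2 := h1.trans hn
        rw [edist_dist] at h2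
        exact (ENNReal.ofReal_le_ofReal_iff (by positivity)).1 h2
      rcases eq_or_ne (Metric.ediam U) 0 with h0 | h0
      · have hlim : Tendsto (fun n : ℕ => ENNReal.ofReal ((A:ℝ) * (l ^ n) ^ (t:ℝ))) atTop (𝓝 0) := by
          have h1 : Tendsto (fun n : ℕ => (A:ℝ) * (l ^ n) ^ (t:ℝ)) atTop (𝓝 0) := by
            have := ((tendsto_pow_atTop_nhds_zero_of_lt_one hl0.le hl1).rpow_const
              (p := (t:ℝ)) (Or.inr ht'.le)).const_mul (A:ℝ)
            simpa [Real.zero_rpow ht'.ne'] using this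
          simpa using ENNReal.tendsto_ofReal h1
        have := ge_of_tendsto' hlim (fun n => key n (by rw [h0]; exact zero_le))
        exact this.trans (zero_le)
      · set d := (Metric.ediam U).toReal with hd
        have hd0 : 0 < d := ENNReal.toReal_pos h0 hUtop
        have hd1 : d ≤ 1 := by
          have := ENNReal.toReal_mono ENNReal.one_ne_top hU
          simpa using this
        have hde : Metric.ediam U = ENNReal.ofReal d := (ENNReal.ofReal_toReal hUtop).symm
        obtain ⟨n, hn1, hn2⟩ := exists_nat_pow_near_of_lt_one hd0 hd1 hl0 hl1
        refine (key n (by rw [hde]; exact ENNReal.ofReal_le_ofReal hn2)).trans ?_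
        rw [hde, ENNReal.ofReal_rpow_of_pos hd0, ← ENNReal.ofReal_mul hD0.le]
        apply ENNReal.ofReal_le_ofReal
        have h3 : (l ^ n) ^ (t:ℝ) * l ^ (t:ℝ) ≤ d ^ (t:ℝ) := by
          rw [← Real.mul_rpow (by positivity) hl0.le, ← pow_succ]
          exact Real.rpow_le_rpow (by positivity) hn1.le ht'.le
        have h4 : 0 < l ^ (t:ℝ) := by positivity
        have h5 : 0 < d ^ (t:ℝ) := by positivity
        have h6 : (l ^ n) ^ (t:ℝ) ≤ (l ^ (t:ℝ))⁻¹ * d ^ (t:ℝ) := by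
          rw [inv_mul_eq_div, le_div_iff₀ h4]; exact h3
        rw [hD, mul_assoc]
        gcongr
        linarith
  have hle := Measure.le_hausdorffMeasure (t:ℝ) ((ENNReal.ofReal D)⁻¹ • ν) 1 one_pos (by
    intro U hU
    rw [Measure.smul_apply, smul_eq_mul]
    calc _ ≤ (ENNReal.ofReal D)⁻¹ * (ENNReal.ofReal D * Metric.ediam U ^ (t:ℝ)) := by
          gcongr; exact hνb U hU
      _ = _ := by
          rw [← mul_assoc, ENNReal.inv_mul_cancel (by simpa using hD0) ENNReal.ofReal_ne_top, one_mul])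
  apply le_dimH_of_hausdorffMeasure_ne_zero
  intro h0
  have h1 := hle (range Φ)
  rw [h0, nonpos_iff_eq_zero, Measure.smul_apply, smul_eq_mul, mul_eq_zero] at h1
  rcases h1 with h1 | h1
  · simp at h1
  · have h2 := Measure.le_map_apply hΦ.aemeasurable (range Φ) (μ := μ.restrict (F A))
    rw [← hν, h1, preimage_range, nonpos_iff_eq_zero, Measure.restrict_apply_univ] at h2
    exact hA h2

/-- projection map -/
def pj (m : ℕ) (x : ℝ) (ω : ℕ → Fin m) : ℝ := ∑' n, ((ω n : ℕ) : ℝ) * x ^ n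

lemma pj_bd (m : ℕ) (x : ℝ) (hx0 : 0 < x) (n : ℕ) (ω : ℕ → Fin m) :
    ‖((ω n : ℕ) : ℝ) * x ^ n‖ ≤ m * x ^ n := by
  rw [Real.norm_eq_abs, abs_of_nonneg (by positivity)]
  gcongr
  exact (ω n).2.le

lemma pj_sum (m : ℕ) (x : ℝ) (hx0 : 0 < x) (hx1 : x < 1) (ω : ℕ → Fin m) :
    Summable fun n => ((ω n : ℕ) : ℝ) * x ^ n :=
  Summable.of_norm_bounded ((summable_geometric_of_lt_one hx0.le hx1).mul_left (m:ℝ))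
    fun n => pj_bd m x hx0 n ω

lemma pj_cont (m : ℕ) (x : ℝ) (hx0 : 0 < x) (hx1 : x < 1) : Continuous (pj m x) := by
  refine continuous_tsum (fun n => ?_) ((summable_geometric_of_lt_one hx0.le hx1).mul_left (m:ℝ))
    fun n ω => pj_bd m x hx0 n ω
  have : Continuous fun i : Fin m => ((i : ℕ) : ℝ) := continuous_of_discreteTopology
  exact (this.comp (continuous_apply n)).mul continuous_const

/-- first `N` letters -/
def wd (m N : ℕ) (ω : ℕ → Fin m) : Fin N → Fin m := fun k => ω k

/-- shifted remainder -/
lemma pj_tail (m : ℕ) (x : ℝ) (hx0 : 0 < x) (hx1 : x < 1) (N : ℕ) (ω : ℕ → Fin m) :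
    Jr 0 x (dg (wd m N ω)) ≤ pj m x ω ∧
      pj m x ω ≤ Jr 0 x (dg (wd m N ω)) + m * (1 - x)⁻¹ * x ^ N := by
  have hs := pj_sum m x hx0 hx1 ω
  have h1 := hs.sum_add_tsum_nat_add N
  have e : Jr 0 x (dg (wd m N ω)) = ∑ i ∈ Finset.range N, ((ω i : ℕ) : ℝ) * x ^ i := by
    rw [Finset.sum_range, Jr]; simp [dg, wd]
  rw [e, pj, ← h1]
  have hb : ∀ i : ℕ, ((ω (i + N) : ℕ) : ℝ) * x ^ (i + N) ≤ (m * x ^ N) * x ^ i := by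
    intro i
    have h2 : ((ω (i + N) : ℕ) : ℝ) ≤ m := by exact_mod_cast (ω (i + N)).2.le
    rw [pow_add]
    calc _ ≤ (m:ℝ) * (x ^ i * x ^ N) := by gcongr
      _ = _ := by ring
  have hg := (summable_geometric_of_lt_one hx0.le hx1)
  have hp : ∑' i : ℕ, ((ω (i + N) : ℕ) : ℝ) * x ^ (i + N) ≤ m * (1 - x)⁻¹ * x ^ N := by
    calc _ ≤ ∑' i : ℕ, (m * x ^ N) * x ^ i :=
          ((summable_nat_add_iff N).2 hs).tsum_le_tsum hb (hg.mul_left _)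
      _ = _ := by rw [tsum_mul_left, tsum_geometric_of_lt_one hx0.le hx1]; ring
  have h0 : 0 ≤ ∑' i : ℕ, ((ω (i + N) : ℕ) : ℝ) * x ^ (i + N) :=
    tsum_nonneg fun i => by positivity
  constructor <;> linarith

/-- Uniform Bernoulli measure. -/
def bern (m : ℕ) [NeZero m] : Measure (ℕ → Fin m) :=
  Measure.infinitePi fun _ : ℕ => (PMF.uniformOfFintype (Fin m)).toMeasure

instance (m : ℕ) [NeZero m] : IsProbabilityMeasure (bern m) := by
  unfold bern; infer_instance

lemma bern_cyl (m : ℕ) [NeZero m] (N : ℕ) (u : Fin N → Fin m) :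
    bern m {ω | wd m N ω = u} ≤ ((m:ℝ≥0∞)⁻¹) ^ N := by
  set t : ℕ → Set (Fin m) := fun k => if h : k < N then {u ⟨k, h⟩} else univ with ht
  have hsub : {ω : ℕ → Fin m | wd m N ω = u} ⊆ Set.pi (Finset.range N) t := by
    intro ω hω k hk
    have hk' : k < N := by simpa using hk
    simp only [ht, hk', dif_pos, mem_singleton_iff]
    exact congrFun hω ⟨k, hk'⟩
  refine (measure_mono hsub).trans ?_
  rw [bern, Measure.infinitePi_pi _ (fun i _ => MeasurableSet.of_discrete)]
  calc _ ≤ ∏ i ∈ Finset.range N, (m:ℝ≥0∞)⁻¹ := by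
        refine Finset.prod_le_prod' fun k hk => ?_
        have hk' : k < N := by simpa using hk
        simp only [ht, hk', dif_pos]
        rw [PMF.toMeasure_uniformOfFintype_apply _ (MeasurableSet.of_discrete)]
        simp
    _ = _ := by simp

lemma bern_pair (m : ℕ) [NeZero m] (N : ℕ) (S : Set (PW m N)) :
    ((bern m).prod (bern m)) {p | (wd m N p.1, wd m N p.2) ∈ S} ≤
      ENNReal.ofReal ((S.ncard : ℝ) / (m:ℝ) ^ (2 * N)) := by
  classical
  have hsub : {p : (ℕ → Fin m) × (ℕ → Fin m) | (wd m N p.1, wd m N p.2) ∈ S} ⊆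
      ⋃ s ∈ S.toFinset, {ω | wd m N ω = s.1} ×ˢ {ω | wd m N ω = s.2} := by
    intro p hp
    simp only [mem_iUnion, Set.mem_toFinset]
    exact ⟨_, hp, rfl, rfl⟩
  refine (measure_mono hsub).trans ((measure_biUnion_finset_le _ _).trans ?_)
  calc _ ≤ ∑ s ∈ S.toFinset, (((m:ℝ≥0∞)⁻¹) ^ N * ((m:ℝ≥0∞)⁻¹) ^ N) := by
        refine Finset.sum_le_sum fun s _ => ?_
        rw [Measure.prod_prod]
        exact mul_le_mul' (bern_cyl m N _) (bern_cyl m N _)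
    _ = _ := by
        have hm0 : (0:ℝ) < m := by exact_mod_cast NeZero.pos m
        rw [Finset.sum_const, nsmul_eq_mul, ← pow_add, ← two_mul, Set.ncard_eq_toFinset_card',
          ENNReal.ofReal_div_of_pos (by positivity), ENNReal.ofReal_pow hm0.le,
          ENNReal.ofReal_natCast, ENNReal.ofReal_natCast, div_eq_mul_inv, ENNReal.inv_pow]

lemma g_pow_eta (m : ℕ) (g l : ℝ) (hg0 : 0 < g) (hg1 : g < 1) (hml : 0 < m * l) :
    g ^ (Real.log (m * l) / Real.log (1 / g)) = (m * l)⁻¹ := by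
  have hlg : Real.log g < 0 := Real.log_neg hg0 hg1
  rw [Real.rpow_def_of_pos hg0, one_div, Real.log_inv]
  rw [show Real.log g * (Real.log (m * l) / -Real.log g) = - Real.log (m * l) by
    field_simp [hlg.ne]]
  rw [Real.exp_neg, Real.exp_log hml]

lemma lower_t (m : ℕ) (hm : 2 ≤ m) (g l : ℝ) (hg0 : 0 < g) (hgl : g < l) (hl1 : l < 1)
    (hml : 1 ≤ m * l) (hC : Claim m g l 0 0) (t : ℝ≥0) (ht : 0 < t)
    (hts : (t:ℝ) < 1 + Real.log (m * l) / Real.log (1 / g)) :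
    (t : ℝ≥0∞) ≤ dimH (range fun ω : ℕ → Fin m => (pj m g ω, pj m l ω)) := by
  haveI : NeZero m := ⟨by omega⟩
  have hl0 : 0 < l := hg0.trans hgl
  have hg1 : g < 1 := hgl.trans hl1
  have hml0 : 0 < m * l := by linarith
  have hη := g_pow_eta m g l hg0 hg1 hml0
  have hη0 : 0 ≤ Real.log (m * l) / Real.log (1 / g) :=
    div_nonneg (Real.log_nonneg hml) (Real.log_nonneg (by rw [le_div_iff₀ hg0]; linarith))
  set η := Real.log (m * l) / Real.log (1 / g)
  set ρ : ℝ := l ^ ((1 + η - t) / 2) with hρ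
  have hρ0 : 0 < ρ := by positivity
  have hρ1 : ρ < 1 := Real.rpow_lt_one hl0.le hl1 (by linarith)
  have hρ2 : ρ * ρ = l ^ (1 + η - t) := by
    rw [hρ, ← Real.rpow_add hl0]; congr 1; ring
  obtain ⟨C, hC0, hCb⟩ := hC ρ⁻¹ ((one_lt_inv₀ hρ0).2 hρ1)
  obtain ⟨K, hK⟩ := exists_nat_ge (1 + m * (1 - l)⁻¹)
  have hKg : 1 + m * (1 - g)⁻¹ ≤ K := by
    refine le_trans ?_ hK
    have : (0:ℝ) < 1 - l := by linarith
    gcongr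
  refine frostman_like (bern m) (fun ω => (pj m g ω, pj m l ω))
    ((pj_cont m g hg0 hg1).prodMk (pj_cont m l hl0 hl1)).measurable l hl0 hl1 t ht
    ((2 * K + 2) ^ 2 * C * (m * l)) ρ (by positivity) hρ0 hρ1 fun n => ?_
  obtain ⟨n1, hn1, hn1'⟩ := exists_nat_pow_near_of_lt_one (x := l ^ n) (y := g) (by positivity)
    (pow_le_one₀ hl0.le hl1.le) hg0 hg1
  have hn1n : n1 ≤ n := by
    by_contra hcon
    have h1 : g ^ n1 ≤ g ^ (n + 1) := pow_le_pow_of_le_one hg0.le hg1.le (by omega)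
    have h2 : g ^ (n + 1) < g ^ n := pow_lt_pow_right_of_lt_one₀ hg0 hg1 (by omega)
    have h3 : g ^ n ≤ l ^ n := by gcongr
    linarith
  set S : Set (PW m n) := {p | (∀ i ≤ 0, |Jr i g (df p) - (fun _ => 0 : ℕ → ℝ) i| ≤ K * g ^ n1) ∧
      (∀ i ≤ 0, |Jr i l (df p) - (fun _ => 0 : ℕ → ℝ) i| ≤ K * l ^ n)} with hS
  have hsub : {p : (ℕ → Fin m) × (ℕ → Fin m) |
      dist (pj m g p.1, pj m l p.1) (pj m g p.2, pj m l p.2) ≤ l ^ n} ⊆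
      {p | (wd m n p.1, wd m n p.2) ∈ S} := by
    rintro ⟨ω, τ⟩ hp
    simp only [mem_setOf_eq, Prod.dist_eq, Real.dist_eq, max_le_iff, abs_le] at hp
    obtain ⟨⟨h1, h2⟩, h3, h4⟩ := hp
    obtain ⟨a1, a2⟩ := pj_tail m g hg0 hg1 n ω
    obtain ⟨a3, a4⟩ := pj_tail m g hg0 hg1 n τ
    obtain ⟨b1, b2⟩ := pj_tail m l hl0 hl1 n ω
    obtain ⟨b3, b4⟩ := pj_tail m l hl0 hl1 n τ
    have e1 : (1 + m * (1 - g)⁻¹) * g ^ n1 ≤ K * g ^ n1 := by gcongr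
    have e2 : (1 + m * (1 - l)⁻¹) * l ^ n ≤ K * l ^ n := by gcongr
    have e3 : m * (1 - g)⁻¹ * g ^ n ≤ m * (1 - g)⁻¹ * g ^ n1 := by
      have : (0:ℝ) < 1 - g := by linarith
      have h5 : g ^ n ≤ g ^ n1 := pow_le_pow_of_le_one hg0.le hg1.le hn1n
      gcongr
    simp only [hS, mem_setOf_eq, Nat.le_zero, forall_eq, Jr_df, sub_zero, abs_le]
    rw [add_mul, one_mul] at e1 e2
    refine ⟨⟨?_, ?_⟩, ?_, ?_⟩ <;> linarith
  refine (measure_mono hsub).trans ((bern_pair m n S).trans (ENNReal.ofReal_le_ofReal ?_))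
  have hcov := cover_AS m n 0 0 g l (g ^ n1) (l ^ n) (by positivity) (by positivity)
      (fun _ => 0) (fun _ => 0) K
  have hcov' : (S.ncard : ℝ) ≤ (2 * K + 2) ^ 2 * ((AS m n 0 0 g l (g ^ n1) (l ^ n)).ncard : ℝ) := by
    exact_mod_cast hcov
  have hb := hCb n1 n hn1n
  have hm0 : (0:ℝ) < m := by exact_mod_cast (by omega : 0 < m)
  have key : l ^ n / ((m:ℝ) * l) ^ n1 ≤ (m * l) * (l ^ n) ^ (1 + η) := by
    have h1 : (g ^ (n1 + 1)) ^ η ≤ (l ^ n) ^ η :=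
      Real.rpow_le_rpow (by positivity) hn1.le hη0
    rw [← Real.rpow_natCast g, ← Real.rpow_mul hg0.le, mul_comm, Real.rpow_mul hg0.le, hη,
      Real.rpow_natCast] at h1
    rw [Real.rpow_add (by positivity), Real.rpow_one]
    calc l ^ n / ((m:ℝ) * l) ^ n1 = (m * l) * (l ^ n * ((m * l)⁻¹) ^ (n1 + 1)) := by
          rw [inv_pow, pow_succ]; field_simp
      _ ≤ _ := by gcongr
  have hsplit : (l ^ n) ^ (1 + η) = ρ ^ n * ρ ^ n * (l ^ n) ^ (t:ℝ) := by
    rw [← mul_pow, hρ2, show 1 + η = (1 + η - t) + t by ring, Real.rpow_add (by positivity)]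
    congr 1
    rw [← Real.rpow_natCast, ← Real.rpow_natCast, ← Real.rpow_mul hl0.le, ← Real.rpow_mul hl0.le]
    congr 1; ring
  rw [div_le_iff₀ (by positivity)]
  calc (S.ncard : ℝ) ≤ (2 * K + 2) ^ 2 *
        (C * ρ⁻¹ ^ n * (l ^ n / ((m:ℝ) * l) ^ n1) * (m:ℝ) ^ (2 * n)) := by
        refine hcov'.trans ?_
        gcongr
    _ ≤ (2 * K + 2) ^ 2 * (C * ρ⁻¹ ^ n * ((m * l) * (ρ ^ n * ρ ^ n * (l ^ n) ^ (t:ℝ))) *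
        (m:ℝ) ^ (2 * n)) := by
        rw [← hsplit]
        gcongr
    _ = _ := by
        rw [inv_pow]; field_simp

lemma upper (m : ℕ) (hm : 2 ≤ m) (g l : ℝ) (hg0 : 0 < g) (hgl : g < l) (hl1 : l < 1)
    (hml : 1 ≤ m * l) :
    dimH (range fun ω : ℕ → Fin m => (pj m g ω, pj m l ω)) ≤
      ENNReal.ofReal (1 + Real.log (m * l) / Real.log (1 / g)) := by
  have hl0 : 0 < l := hg0.trans hgl
  have hg1 : g < 1 := hgl.trans hl1
  have hml0 : 0 < m * l := by linarith
  have hm0 : (0:ℝ) < m := by exact_mod_cast (by omega : 0 < m)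
  have hη := g_pow_eta m g l hg0 hg1 hml0
  have hη0 : 0 ≤ Real.log (m * l) / Real.log (1 / g) :=
    div_nonneg (Real.log_nonneg hml) (Real.log_nonneg (by rw [le_div_iff₀ hg0]; linarith))
  set η := Real.log (m * l) / Real.log (1 / g)
  set s : ℝ≥0 := Real.toNNReal (1 + η) with hs
  have hsr : (s:ℝ) = 1 + η := Real.coe_toNNReal _ (by linarith)
  change _ ≤ (s : ℝ≥0∞)
  apply dimH_le_of_hausdorffMeasure_ne_top
  set c : ℝ := m * (1 - l)⁻¹ with hc
  have h1l : 0 < 1 - l := by linarith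
  have hinv : 1 ≤ (1 - l)⁻¹ := (one_le_inv₀ h1l).2 (by linarith)
  have hc1 : 1 ≤ c := by
    have : (2:ℝ) ≤ m := by exact_mod_cast hm
    rw [hc]; nlinarith
  have hcg : m * (1 - g)⁻¹ ≤ c := by rw [hc]; gcongr
  set M : ℕ → ℕ := fun n => ⌊c * (l / g) ^ n⌋₊ + 1 with hM
  have hr1 : ∀ n : ℕ, 1 ≤ (l / g) ^ n := fun n =>
    one_le_pow₀ ((one_le_div hg0).2 hgl.le)
  have hMb : ∀ n, (M n : ℝ) ≤ 2 * c * (l / g) ^ n := by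
    intro n
    have h1 : ((⌊c * (l / g) ^ n⌋₊ : ℕ) : ℝ) ≤ c * (l / g) ^ n :=
      Nat.floor_le (by have := hr1 n; positivity)
    have h2 : 1 ≤ c * (l / g) ^ n := one_le_mul_of_one_le_of_one_le hc1 (hr1 n)
    simp only [hM]; push_cast; linarith
  set T : ∀ n : ℕ, ((Fin n → Fin m) × Fin (M n)) → Set (ℝ × ℝ) := fun n i =>
    {p | ∃ ω : ℕ → Fin m, p = (pj m g ω, pj m l ω) ∧ wd m n ω = i.1 ∧
      ⌊(pj m l ω - Jr 0 l (dg (wd m n ω))) / g ^ n⌋₊ = (i.2 : ℕ)} with hT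
  have hdiam : ∀ n i, Metric.ediam (T n i) ≤ ENNReal.ofReal (c * g ^ n) := by
    intro n i
    refine Metric.ediam_le ?_
    rintro _ ⟨ω, rfl, hω, hω'⟩ _ ⟨τ, rfl, hτ, hτ'⟩
    rw [edist_dist]
    refine ENNReal.ofReal_le_ofReal ?_
    simp only [Prod.dist_eq, Real.dist_eq, max_le_iff]
    have hgn : 0 < g ^ n := by positivity
    obtain ⟨a1, a2⟩ := pj_tail m g hg0 hg1 n ω
    obtain ⟨a3, a4⟩ := pj_tail m g hg0 hg1 n τ
    obtain ⟨b1, b2⟩ := pj_tail m l hl0 hl1 n ω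
    obtain ⟨b3, b4⟩ := pj_tail m l hl0 hl1 n τ
    rw [hω] at a1 a2 b1 b2 hω'
    rw [hτ] at a3 a4 b3 b4 hτ'
    have e : m * (1 - g)⁻¹ * g ^ n ≤ c * g ^ n := by gcongr
    have e' : 1 * g ^ n ≤ c * g ^ n := by gcongr
    have f1 := Nat.floor_le (div_nonneg (sub_nonneg.2 b1) hgn.le)
    have f2 := Nat.lt_floor_add_one ((pj m l ω - Jr 0 l (dg i.1)) / g ^ n)
    have f3 := Nat.floor_le (div_nonneg (sub_nonneg.2 b3) hgn.le)
    have f4 := Nat.lt_floor_add_one ((pj m l τ - Jr 0 l (dg i.1)) / g ^ n)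
    rw [hω', le_div_iff₀ hgn] at f1
    rw [hτ', le_div_iff₀ hgn] at f3
    rw [hω', div_lt_iff₀ hgn] at f2
    rw [hτ', div_lt_iff₀ hgn] at f4
    constructor <;> rw [abs_le] <;> constructor <;> linarith
  have hcov : ∀ n, (range fun ω : ℕ → Fin m => (pj m g ω, pj m l ω)) ⊆ ⋃ i, T n i := by
    rintro n _ ⟨ω, rfl⟩
    obtain ⟨b1, b2⟩ := pj_tail m l hl0 hl1 n ω
    have hgn : 0 < g ^ n := by positivity
    have hlt : ⌊(pj m l ω - Jr 0 l (dg (wd m n ω))) / g ^ n⌋₊ < M n := by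
      simp only [hM]
      refine Nat.lt_succ_of_le (Nat.floor_le_floor ?_)
      rw [div_pow, ← mul_div_assoc]
      gcongr
      linarith
    exact mem_iUnion.2 ⟨(wd m n ω, ⟨_, hlt⟩), ω, rfl, rfl, rfl⟩
  have hlim : Tendsto (fun n : ℕ => ENNReal.ofReal (c * g ^ n)) atTop (𝓝 0) := by
    have := (tendsto_pow_atTop_nhds_zero_of_lt_one hg0.le hg1).const_mul c
    rw [mul_zero] at this
    simpa using ENNReal.tendsto_ofReal this
  have hmeas := Measure.hausdorffMeasure_le_liminf_sum (s:ℝ)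
    (range fun ω : ℕ → Fin m => (pj m g ω, pj m l ω)) (fun n => ENNReal.ofReal (c * g ^ n)) hlim T
    (Eventually.of_forall hdiam) (Eventually.of_forall hcov)
  refine ne_top_of_le_ne_top (ENNReal.ofReal_ne_top (r := 2 * c * c ^ (s:ℝ))) (hmeas.trans ?_)
  refine liminf_le_of_le (by isBoundedDefault) fun b hb => ?_
  obtain ⟨n, hn⟩ := hb.exists
  refine hn.trans ?_
  calc _ ≤ ∑ i : (Fin n → Fin m) × Fin (M n), ENNReal.ofReal ((c * g ^ n) ^ (s:ℝ)) := by
        refine Finset.sum_le_sum fun i _ => ?_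
        rw [← ENNReal.ofReal_rpow_of_nonneg (by positivity) s.coe_nonneg]
        exact ENNReal.rpow_le_rpow (hdiam n i) s.coe_nonneg
    _ = ENNReal.ofReal ((m:ℝ) ^ n * M n * (c * g ^ n) ^ (s:ℝ)) := by
        rw [Finset.sum_const, nsmul_eq_mul, ENNReal.ofReal_mul (by positivity),
          ENNReal.ofReal_mul (by positivity), ENNReal.ofReal_pow hm0.le]
        simp
    _ ≤ _ := by
        refine ENNReal.ofReal_le_ofReal ?_
        have e1 : (g ^ n) ^ (s:ℝ) = g ^ n * ((m * l)⁻¹) ^ n := by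
          rw [hsr, Real.rpow_add (by positivity), Real.rpow_one, ← Real.rpow_natCast,
            ← Real.rpow_mul hg0.le, mul_comm (n:ℝ) η, Real.rpow_mul hg0.le, hη,
            Real.rpow_natCast, Real.rpow_natCast]
        rw [Real.mul_rpow (by positivity) (by positivity), e1]
        calc _ ≤ (m:ℝ) ^ n * (2 * c * (l / g) ^ n) * (c ^ (s:ℝ) * (g ^ n * ((m * l)⁻¹) ^ n)) := by
              gcongr
              exact hMb n
          _ = 2 * c * c ^ (s:ℝ) := by
              rw [div_pow, inv_pow, mul_pow]; field_simp

lemma final_dim (m : ℕ) (hm : 2 ≤ m) (g l : ℝ) (hg0 : 0 < g) (hgl : g < l) (hl1 : l < 1)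
    (hml : 1 ≤ m * l) (hC : Claim m g l 0 0) :
    dimH (range fun ω : ℕ → Fin m => (pj m g ω, pj m l ω)) =
      ENNReal.ofReal (1 + Real.log (m * l) / Real.log (1 / g)) := by
  refine le_antisymm (upper m hm g l hg0 hgl hl1 hml) ?_
  refine le_of_forall_lt fun a ha => ?_
  lift a to ℝ≥0 using ha.ne_top
  obtain ⟨b, hab, hb⟩ := ENNReal.lt_iff_exists_nnreal_btwn.1 ha
  refine hab.trans_le (lower_t m hm g l hg0 hgl hl1 hml hC b ?_ ?_)
  · have := ENNReal.coe_lt_coe.1 hab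
    exact pos_of_gt this
  · rw [ENNReal.ofReal, ENNReal.coe_lt_coe] at hb
    exact (Real.lt_toNNReal_iff_coe_lt).1 hb

/-- For the digit set `D = {0,1,…,m−1}` (`m ≥ 2`), for Lebesgue-a.e. `(γ,λ) ∈ Γ(0,1/m)`,
the Hausdorff dimension of `K_{γ,λ}` equals `1 + log(mλ)/log(1/γ)`. -/
theorem hausdorff_dimension_integer_digits (m : ℕ) (hm : 2 ≤ m) :
    ∀ᵐ p : ℝ × ℝ ∂volume,
      p ∈ Gamma m 0 (1 / m) →
        dimH (Kaff m (fun i => (i.1 : ℝ)) p.1 p.2) =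
          ENNReal.ofReal (1 + Real.log (m * p.2) / Real.log (1 / p.1)) := by
  have hall : ∀ᵐ z : ℝ × ℝ ∂volume, ∀ j k : ℕ,
      z ∈ Ioo (0:ℝ) 1 ×ˢ Ioo (0:ℝ) 1 → HGood m z.1 z.2 j k :=
    ae_all_iff.2 fun j => ae_all_iff.2 fun k => ae_GS m (by omega) j k
  filter_upwards [hall] with p hp hpG
  obtain ⟨hg0, hgl, hl1, hml, -, hlt⟩ := hpG
  have hm0 : (0:ℝ) < m := by exact_mod_cast (by omega : 0 < m)
  have hl0 : 0 < p.2 := hg0.trans hgl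
  have hg1 : p.1 < 1 := hgl.trans hl1
  have h1 : 1 ≤ m * p.2 := by
    rw [div_lt_iff₀ hm0] at hml; linarith
  have h2 : m * p.2 * p.1 ≤ 1 := by
    rw [lt_div_iff₀ hm0] at hlt; nlinarith
  have hC := Claim_main m hm p.1 p.2 hg0 hg1 hl0 hl1 h1 h2
    fun j k => hp j k ⟨⟨hg0, hg1⟩, hl0, hl1⟩
  rw [← final_dim m hm p.1 p.2 hg0 hgl hl1 h1 hC]
  congr 1
  ext q
  constructor
  · rintro ⟨ω, rfl⟩
    exact ⟨ω, rfl⟩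
  · rintro ⟨ω, rfl⟩
    exact ⟨ω, rfl⟩
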